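/- arXiv:1111.5561 — 5 statements merged into one kernel-verified Lean document; each statement's English description precedes it below -/
import Mathlib

section
/- Let f be a homeomorphism of the torus T² homotopic to a Dehn twist, with lift f̂ to the vertical cylinder A. Suppose 0 ∈ ρ_V(f̂) (so B_S⁻ is nonempty). If ω(B_S⁻) = ∅, then there exists ε > 0 such that [−ε, 0] ⊆ ρ_V(f̂). -/
noncomputable section

open MeasureTheory

abbrev Torus := AddCircle (1 : ℝ) × AddCircle (1 : ℝ)
abbrev Cyl := AddCircle (1 : ℝ) × ℝ

/-- The covering map from the plane to the vertical cylinder. -/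
def projCyl (z : ℝ × ℝ) : Cyl := ((z.1 : AddCircle (1 : ℝ)), z.2)

/-- The covering map from the plane to the torus. -/
def projTorus (z : ℝ × ℝ) : Torus := ((z.1 : AddCircle (1 : ℝ)), (z.2 : AddCircle (1 : ℝ)))

/-- A lift to the plane of a torus homeomorphism homotopic to a Dehn twist:
a homeomorphism of the plane commuting with integer horizontal translations and
satisfying the Dehn-twist relation for vertical translations, with twist
coefficient `k > 0`. -/
structure DehnLift where
  F : (ℝ × ℝ) ≃ₜ (ℝ × ℝ)
  k : ℤ
  k_pos : 0 < k
  horiz : ∀ x y : ℝ, F (x + 1, y) = F (x, y) + (1, 0)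
  vert : ∀ x y : ℝ, F (x, y + 1) = F (x, y) + ((k : ℝ), 1)

/-- The vertical rotation set of a cylinder map:
`ρ_V(f̂) = ∩_{i≥1} closure( ∪_{n≥i} { (p₂(f̂ⁿ(ẑ)) − p₂(ẑ))/n : ẑ ∈ A } )`. -/
def rotSet (fhat : Cyl → Cyl) : Set ℝ :=
  ⋂ i : ℕ, closure (⋃ n : ℕ, ⋃ _ : i + 1 ≤ n,
    {r : ℝ | ∃ z : Cyl, r = ((fhat^[n] z).2 - z.2) / n})

/-- A subset of the cylinder is bounded iff its second-coordinate projection is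
a bounded subset of `ℝ`. -/
def VBounded (S : Set Cyl) : Prop := ∃ M : ℝ, ∀ z ∈ S, |z.2| ≤ M

/-- `B⁻ = {ẑ : f̂ⁿ(ẑ) ∈ H⁻ for all n ≥ 0}` where `H⁻ = (ℝ/ℤ)×(−∞,0]`. -/
def Bminus (fhat : Cyl → Cyl) : Set Cyl := {z | ∀ n : ℕ, (fhat^[n] z).2 ≤ 0}

/-- `B⁺ = {ẑ : f̂ⁿ(ẑ) ∈ H⁺ for all n ≥ 0}` where `H⁺ = (ℝ/ℤ)×[0,∞)`. -/
def Bplus (fhat : Cyl → Cyl) : Set Cyl := {z | ∀ n : ℕ, 0 ≤ (fhat^[n] z).2}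

/-- `B_S⁻`: the union of the unbounded connected components of `B⁻`. -/
def BS (fhat : Cyl → Cyl) : Set Cyl :=
  {z | z ∈ Bminus fhat ∧ ¬ VBounded (connectedComponentIn (Bminus fhat) z)}

/-- `B_N⁺`: the union of the unbounded connected components of `B⁺`. -/
def BN (fhat : Cyl → Cyl) : Set Cyl :=
  {z | z ∈ Bplus fhat ∧ ¬ VBounded (connectedComponentIn (Bplus fhat) z)}

/-- The ω-limit set `ω(S) = ∩_{n≥0} closure(∪_{i≥n} f̂ⁱ(S))`. -/
def omegaSet (fhat : Cyl → Cyl) (S : Set Cyl) : Set Cyl :=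
  ⋂ n : ℕ, closure (⋃ i : ℕ, ⋃ _ : n ≤ i, fhat^[i] '' S)

section Helpers

open Set Filter Topology

/-- Vertical translation of the cylinder. -/
def shv (c : ℝ) (z : Cyl) : Cyl := (z.1, z.2 + c)

lemma shv_cont (c : ℝ) : Continuous (shv c) := by
  unfold shv; fun_prop

lemma projCyl_open : IsOpenQuotientMap projCyl :=
  (QuotientAddGroup.isOpenQuotientMap_mk (N := AddSubgroup.zmultiples (1:ℝ))).prodMap
    (IsOpenQuotientMap.id (X := ℝ))

lemma cyl_lc : LocallyConnectedSpace Cyl :=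
  projCyl_open.isQuotientMap.isCoinducing.locallyConnectedSpace

lemma F_int (L : DehnLift) (m : ℤ) : ∀ x y : ℝ, L.F (x + m, y) = L.F (x, y) + ((m:ℝ), 0) := by
  induction m using Int.induction_on with
  | zero => intro x y; ext <;> simp
  | succ n ih =>
    intro x y
    have h := L.horiz (x + n) y
    have h2 := ih x y
    push_cast at *
    rw [show x + ((n:ℝ) + 1) = x + n + 1 by ring, h, h2]
    ext <;> simp <;> ring
  | pred n ih =>
    intro x y
    have h := L.horiz (x + (-n - 1)) y
    have h2 := ih x y
    push_cast at *
    rw [show x + (-(n:ℝ) - 1) + 1 = x + -n by ring, h2] at h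
    have h1 := congrArg Prod.fst h
    have h3 := congrArg Prod.snd h
    simp at h1 h3
    ext
    · simp; linarith
    · simp; linarith

lemma projCyl_eq {a b : ℝ × ℝ} (h : projCyl a = projCyl b) :
    ∃ m : ℤ, a = (b.1 + m, b.2) := by
  unfold projCyl at h
  have h1 := congrArg Prod.fst h
  have h2 := congrArg Prod.snd h
  simp only at h1 h2
  have h3 := (QuotientAddGroup.eq_iff_sub_mem).1 h1
  obtain ⟨m, hm⟩ := AddSubgroup.mem_zmultiples_iff.1 h3
  refine ⟨m, ?_⟩
  simp at hm
  ext
  · simp; linarith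
  · exact h2

lemma projCyl_add (x y : ℝ) (m : ℤ) : projCyl (x + m, y) = projCyl (x, y) := by
  unfold projCyl
  ext
  · simp only
    apply (QuotientAddGroup.eq_iff_sub_mem).2
    exact AddSubgroup.mem_zmultiples_iff.2 ⟨m, by simp⟩
  · rfl

/-- The cylinder map as a homeomorphism. -/
lemma exists_homeo (L : DehnLift) (fhat : Cyl → Cyl)
    (hfhat : ∀ z : ℝ × ℝ, projCyl (L.F z) = fhat (projCyl z)) :
    ∃ e : Cyl ≃ₜ Cyl, ⇑e = fhat := by
  have hq := projCyl_open
  have hc : Continuous fhat := by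
    rw [← hq.continuous_comp_iff]
    have : fhat ∘ projCyl = projCyl ∘ L.F := by funext z; exact (hfhat z).symm
    rw [this]
    exact hq.continuous.comp L.F.continuous
  have ho : IsOpenMap fhat := by
    intro O hO
    have : fhat '' O = projCyl '' (L.F '' (projCyl ⁻¹' O)) := by
      rw [← image_comp]
      have h2 : projCyl ∘ L.F = fhat ∘ projCyl := by funext z; exact hfhat z
      rw [h2, image_comp, image_preimage_eq _ hq.surjective]
    rw [this]
    exact hq.isOpenMap _ (L.F.isOpenMap _ (hO.preimage hq.continuous))
  have hb : Function.Bijective fhat := by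
    constructor
    · intro a b hab
      obtain ⟨a, rfl⟩ := hq.surjective a
      obtain ⟨b, rfl⟩ := hq.surjective b
      rw [← hfhat, ← hfhat] at hab
      obtain ⟨m, hm⟩ := projCyl_eq hab
      have h3 : L.F a = L.F (b.1 + m, b.2) := by
        rw [F_int, hm]; ext <;> simp
      have h4 := L.F.injective h3
      rw [h4, projCyl_add]
    · intro a
      obtain ⟨a, rfl⟩ := hq.surjective a
      exact ⟨projCyl (L.F.symm a), by rw [← hfhat]; simp⟩
  exact ⟨(Equiv.ofBijective fhat hb).toHomeomorphOfContinuousOpen hc ho, rfl⟩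

lemma fhat_shift (L : DehnLift) (fhat : Cyl → Cyl)
    (hfhat : ∀ z : ℝ × ℝ, projCyl (L.F z) = fhat (projCyl z)) (c : ℤ) :
    ∀ z, fhat (shv c z) = shv c (fhat z) := by
  have h1 : ∀ z, fhat (shv 1 z) = shv 1 (fhat z) := by
    intro z
    obtain ⟨⟨x, y⟩, rfl⟩ := projCyl_open.surjective z
    have : shv 1 (projCyl (x, y)) = projCyl (x, y + 1) := rfl
    rw [this, ← hfhat, ← hfhat, L.vert]
    have h2 := projCyl_add (L.F (x, y)).1 ((L.F (x,y)).2 + 1) L.k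
    exact h2
  induction c using Int.induction_on with
  | zero => intro z; simp [shv]
  | succ n ih =>
    intro z
    have e : ∀ w, shv ((n + 1 : ℤ) : ℝ) w = shv 1 (shv ((n:ℤ):ℝ) w) := by
      intro w; simp [shv]; ring
    rw [e, e, h1, ih]
  | pred n ih =>
    intro z
    have e : ∀ w, shv 1 (shv ((-n - 1 : ℤ) : ℝ) w) = shv ((-n:ℤ):ℝ) w := by
      intro w; simp [shv]; ring
    have h2 := ih z
    rw [← e, h1, ← e] at h2
    have hinj : Function.Injective (shv 1) := by
      intro a b hab
      simp [shv] at hab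
      exact Prod.ext hab.1 hab.2
    exact hinj h2

lemma isCompact_band (a b : ℝ) : IsCompact {z : Cyl | a ≤ z.2 ∧ z.2 ≤ b} := by
  have : {z : Cyl | a ≤ z.2 ∧ z.2 ≤ b} = (univ : Set (AddCircle (1:ℝ))) ×ˢ Icc a b := by
    ext z; simp
  rw [this]
  exact isCompact_univ.prod isCompact_Icc

variable {f : Cyl → Cyl}

lemma exists_rep (z : Cyl) : ∃ c : ℤ, 0 ≤ (shv c z).2 ∧ (shv c z).2 < 1 :=
  ⟨-⌊z.2⌋, by simp only [shv]; push_cast; linarith [Int.floor_le z.2], by simp only [shv]; push_cast; linarith [Int.lt_floor_add_one z.2]⟩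

lemma bdd_disp (hc : Continuous f) (hs : ∀ (c : ℤ) z, f (shv c z) = shv c (f z)) :
    ∃ K : ℝ, 0 ≤ K ∧ ∀ z, |(f z).2 - z.2| ≤ K := by
  obtain ⟨K, hK⟩ := (isCompact_band 0 1).exists_bound_of_continuousOn
    (f := fun z : Cyl => (f z).2 - z.2) (by fun_prop)
  have key : ∀ z, |(f z).2 - z.2| ≤ K := by
    intro z
    obtain ⟨c, h0, h1⟩ := exists_rep z
    have h := hK (shv c z) ⟨h0, h1.le⟩
    rw [hs] at h
    simpa [shv] using h
  exact ⟨K, (abs_nonneg _).trans (key (0, 0)), key⟩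

lemma iter_disp {K : ℝ} (hK : ∀ z, |(f z).2 - z.2| ≤ K) (n : ℕ) (z : Cyl) :
    |(f^[n] z).2 - z.2| ≤ n * K := by
  induction n with
  | zero => simp
  | succ n ih =>
    rw [Function.iterate_succ_apply']
    have := hK (f^[n] z)
    rw [abs_le] at *
    push_cast
    constructor <;> linarith [this.1, this.2, ih.1, ih.2]

lemma iter_shift (hs : ∀ (c : ℤ) z, f (shv c z) = shv c (f z)) (n : ℕ) (c : ℤ) (z : Cyl) :
    f^[n] (shv c z) = shv c (f^[n] z) := by
  induction n with
  | zero => rfl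
  | succ n ih => rw [Function.iterate_succ_apply', Function.iterate_succ_apply', ih, hs]

/-- If every point has displacement with `s * disp ≥ δ > 0` at time `m`, zero is not in the
rotation set; `s` is `1` or `-1`. -/
lemma not_unif {K : ℝ} (hK0 : 0 ≤ K) (hK : ∀ z, |(f z).2 - z.2| ≤ K) (h0 : (0:ℝ) ∈ rotSet f)
    (s : ℝ) (hs : |s| = 1) (m : ℕ) (δ : ℝ) (hδ : 0 < δ)
    (h : ∀ z, δ ≤ s * ((f^[m] z).2 - z.2)) : False := by
  have hm : 0 < m := by
    rcases Nat.eq_zero_or_pos m with rfl | h'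
    · have := h (0, 0)
      simp at this; linarith
    · exact h'
  have hmR : (0:ℝ) < m := by exact_mod_cast hm
  have hq : ∀ (q : ℕ) z, q * δ ≤ s * ((f^[m * q] z).2 - z.2) := by
    intro q
    induction q with
    | zero => intro z; simp
    | succ q ih =>
      intro z
      rw [Nat.mul_succ, Nat.add_comm (m * q), Function.iterate_add_apply]
      have h1 := h (f^[m * q] z)
      have h2 := ih z
      push_cast
      linarith
  have hall : ∀ (n : ℕ) z, (n / m : ℝ) * δ - δ - m * K ≤ s * ((f^[n] z).2 - z.2) := by
    intro n z
    have hn := Nat.div_add_mod n m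
    have hr := Nat.mod_lt n hm
    set q := n / m
    set r := n % m
    have h1 := hq q z
    have h2 := iter_disp hK r (f^[m * q] z)
    rw [← Function.iterate_add_apply, Nat.add_comm r, hn] at h2
    have h3 : |s * ((f^[n] z).2 - (f^[m * q] z).2)| ≤ r * K := by
      rw [abs_mul, hs, one_mul]; exact h2
    have h4 := (abs_le.1 h3).1
    have h5 : (r:ℝ) * K ≤ m * K := by
      apply mul_le_mul_of_nonneg_right _ hK0
      exact_mod_cast hr.le
    have h6 : (n:ℝ) / m ≤ q + 1 := by
      rw [div_le_iff₀ hmR]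
      have : n ≤ (q + 1) * m := by nlinarith
      exact_mod_cast this
    have h7 : (n:ℝ) / m * δ ≤ (q + 1) * δ := mul_le_mul_of_nonneg_right h6 hδ.le
    linarith
  -- choose i large
  obtain ⟨i, hi⟩ := exists_nat_gt ((δ + m * K) * (2 * m) / δ)
  have hmem := mem_iInter.1 h0 i
  rw [Metric.mem_closure_iff] at hmem
  obtain ⟨r, hr, hd⟩ := hmem (δ / (2 * m)) (by positivity)
  simp only [mem_iUnion, mem_ofPred_eq] at hr
  obtain ⟨n, hn, z, rfl⟩ := hr
  have hn0 : (0:ℝ) < n := by exact_mod_cast (by omega : 0 < n)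
  have hin : (i:ℝ) < n := by exact_mod_cast (by omega : i < n)
  rw [dist_comm, Real.dist_eq, sub_zero, abs_div, abs_of_pos hn0, div_lt_iff₀ hn0] at hd
  have h1 := hall n z
  have h2 : s * ((f^[n] z).2 - z.2) ≤ |(f^[n] z).2 - z.2| := by
    calc _ ≤ |s * ((f^[n] z).2 - z.2)| := le_abs_self _
      _ = _ := by rw [abs_mul, hs, one_mul]
  rw [div_lt_iff₀ hδ] at hi
  have h3 : (n:ℝ) / m * δ - δ / (2 * m) * n = n * δ / (2 * m) := by
    field_simp; ring
  have h4 : δ + m * K < n * δ / (2 * m) := by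
    rw [lt_div_iff₀ (by positivity)]
    nlinarith
  linarith

lemma Bminus_closed (hc : Continuous f) : IsClosed (Bminus f) := by
  have : Bminus f = ⋂ n : ℕ, {z | (f^[n] z).2 ≤ 0} := by ext z; simp [Bminus]
  rw [this]
  exact isClosed_iInter fun n =>
    isClosed_le (continuous_snd.comp (hc.iterate n)) continuous_const

/-- A bounded component of a closed subset of the cylinder has a bounded open
neighbourhood whose frontier misses the set. -/
lemma local_sep {X : Set Cyl} (hX : IsClosed X) (hX0 : ∀ z ∈ X, z.2 ≤ 0) {z : Cyl} (hz : z ∈ X)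
    (hb : VBounded (connectedComponentIn X z)) :
    ∃ O : Set Cyl, IsOpen O ∧ z ∈ O ∧ VBounded O ∧ frontier O ∩ X = ∅ := by
  obtain ⟨M, hM⟩ := hb
  have hzC : z ∈ connectedComponentIn X z := mem_connectedComponentIn hz
  have hzM := hM z hzC
  have hzM' := abs_le.1 hzM
  let Y : Set Cyl := X ∩ {w | -M - 1 ≤ w.2}
  have hYcl : IsClosed Y := hX.inter (isClosed_le continuous_const continuous_snd)
  have hYc : IsCompact Y :=
    (isCompact_band (-M - 1) 0).of_isClosed_subset hYcl fun w hw => ⟨hw.2, hX0 w hw.1⟩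
  have hzY : z ∈ Y := ⟨hz, by simp only [mem_ofPred_eq]; linarith⟩
  haveI : CompactSpace Y := isCompact_iff_compactSpace.1 hYc
  let y : Y := ⟨z, hzY⟩
  -- the component in `Y` lies above `-M`
  have hcomp : ∀ w ∈ connectedComponent y, -M ≤ (w : Cyl).2 := by
    intro w hw
    have h1 : IsPreconnected ((Subtype.val : Y → Cyl) '' connectedComponent y) :=
      isPreconnected_connectedComponent.image _ continuous_subtype_val.continuousOn
    have h2 := h1.subset_connectedComponentIn (F := X) (x := z) ⟨y, mem_connectedComponent, rfl⟩
      (by rintro _ ⟨v, _, rfl⟩; exact v.2.1)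
    exact (abs_le.1 (hM _ (h2 ⟨w, hw, rfl⟩))).1
  have hE : IsCompact {w : Y | (w : Cyl).2 ≤ -M - 1} :=
    (isClosed_le (continuous_snd.comp continuous_subtype_val) continuous_const).isCompact
  rw [connectedComponent_eq_iInter_isClopen] at hcomp
  haveI : Nonempty {s : Set Y // IsClopen s ∧ y ∈ s} := ⟨⟨univ, isClopen_univ, mem_univ _⟩⟩
  obtain ⟨⟨s, hscl, hys⟩, hsE⟩ := hE.elim_directed_family_closed
    (fun s : {s : Set Y // IsClopen s ∧ y ∈ s} => s.1) (fun s => s.2.1.1)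
    (by
      rw [eq_empty_iff_forall_notMem]
      rintro w ⟨hw1, hw2⟩
      have := hcomp w hw2
      simp only [mem_ofPred_eq] at hw1
      linarith)
    (by
      intro a b
      exact ⟨⟨a.1 ∩ b.1, a.2.1.inter b.2.1, a.2.2, b.2.2⟩, inter_subset_left, inter_subset_right⟩)
  simp only at hsE
  -- the clopen piece `V` as a subset of the cylinder
  let V : Set Cyl := Subtype.val '' s
  have hVc : IsCompact V := hscl.1.isCompact.image continuous_subtype_val
  obtain ⟨P, hP, hPs⟩ := isOpen_induced_iff.1 hscl.2
  have hVM : ∀ w ∈ V, -M - 1 < w.2 := by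
    rintro _ ⟨v, hv, rfl⟩
    by_contra hcon
    have : v ∈ ({w : Y | (w : Cyl).2 ≤ -M - 1} ∩ s) := ⟨not_lt.1 hcon, hv⟩
    rw [hsE] at this
    exact this
  let W : Set Cyl := P ∩ {w | -M - 1 < w.2} ∩ {w | w.2 < 1}
  have hWo : IsOpen W := (hP.inter (isOpen_lt continuous_const continuous_snd)).inter
    (isOpen_lt continuous_snd continuous_const)
  have hVW : V ⊆ W := by
    intro w hw
    refine ⟨⟨?_, hVM w hw⟩, ?_⟩
    · obtain ⟨v, hv, rfl⟩ := hw
      rw [← hPs] at hv; exact hv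
    · obtain ⟨v, hv, rfl⟩ := hw
      have := hX0 _ v.2.1
      simp only [mem_ofPred_eq]; linarith
  have hWX : W ∩ X ⊆ V := by
    rintro w ⟨⟨⟨h1, h2⟩, _⟩, h3⟩
    have h2' : -M - 1 ≤ w.2 := le_of_lt (show -M - 1 < w.2 from h2)
    refine ⟨⟨w, h3, h2'⟩, ?_, rfl⟩
    rw [← hPs]; exact h1
  obtain ⟨Q, hQc, hVQ, hQW⟩ := exists_compact_between hVc hWo hVW
  refine ⟨interior Q, isOpen_interior, hVQ ⟨y, hys, rfl⟩, ⟨|M| + 1, ?_⟩, ?_⟩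
  · intro w hw
    have h1 := hQW (interior_subset hw)
    have h2 : -M - 1 < w.2 := h1.1.2
    have h3 : w.2 < 1 := h1.2
    rw [abs_le]
    constructor
    · linarith [le_abs_self M]
    · linarith [abs_nonneg M]
  · rw [eq_empty_iff_forall_notMem]
    rintro w ⟨hw1, hw2⟩
    have h1 : w ∈ Q := hQc.isClosed.closure_subset_iff.2 interior_subset hw1.1
    have h2 := hVQ (hWX ⟨hQW h1, hw2⟩)
    have h3 := hw1.2
    rw [interior_interior] at h3
    exact h3 h2

/-- If `0` is in the rotation set then `B_S⁻` is nonempty. -/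
lemma BS_nonempty (e : Cyl ≃ₜ Cyl) (hs : ∀ (c : ℤ) z, e (shv c z) = shv c (e z))
    (h0 : (0:ℝ) ∈ rotSet e) : (BS e).Nonempty := by
  haveI := cyl_lc
  obtain ⟨K, hK0, hK⟩ := bdd_disp e.continuous hs
  by_contra hne
  rw [not_nonempty_iff_eq_empty, eq_empty_iff_forall_notMem] at hne
  set X := Bminus e with hXdef
  have hXcl : IsClosed X := Bminus_closed e.continuous
  have hX0 : ∀ z ∈ X, z.2 ≤ 0 := fun z hz => hz 0
  have hit : ∀ n, Continuous (e^[n]) := fun n => e.continuous.iterate n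
  -- step 1: a bounded open set containing the upper part of X, with frontier missing X
  obtain ⟨O, hO, hQO, ⟨M1, hM1⟩, hfr⟩ : ∃ O : Set Cyl, IsOpen O ∧
      X ∩ {z | -1 ≤ z.2 ∧ z.2 ≤ 0} ⊆ O ∧ VBounded O ∧ frontier O ∩ X = ∅ := by
    have hQ : IsCompact (X ∩ {z : Cyl | -1 ≤ z.2 ∧ z.2 ≤ 0}) := (isCompact_band _ _).inter_left hXcl
    refine hQ.induction_on (p := fun s => ∃ O : Set Cyl, IsOpen O ∧
      s ⊆ O ∧ VBounded O ∧ frontier O ∩ X = ∅) ?_ ?_ ?_ ?_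
    · exact ⟨∅, isOpen_empty, Subset.rfl, ⟨0, by simp⟩, by simp⟩
    · rintro s t hst ⟨O, h1, h2, h3⟩
      exact ⟨O, h1, hst.trans h2, h3⟩
    · rintro s t ⟨O, h1, h2, ⟨M, h3⟩, h4⟩ ⟨O', h1', h2', ⟨M', h3'⟩, h4'⟩
      refine ⟨O ∪ O', h1.union h1', union_subset_union h2 h2', ⟨max M M', ?_⟩, ?_⟩
      · rintro z (hz | hz)
        · exact (h3 z hz).trans (le_max_left _ _)
        · exact (h3' z hz).trans (le_max_right _ _)
      · rw [eq_empty_iff_forall_notMem] at *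
        rintro z ⟨hz1, hz2⟩
        rcases frontier_union_subset O O' hz1 with h | h
        · exact h4 z ⟨h.1, hz2⟩
        · exact h4' z ⟨h.2, hz2⟩
    · intro z hz
      have hb : VBounded (connectedComponentIn X z) := by
        by_contra hcon
        exact hne z ⟨hz.1, hcon⟩
      obtain ⟨O, h1, h2, h3, h4⟩ := local_sep hXcl hX0 hz.1 hb
      exact ⟨O, mem_nhdsWithin_of_mem_nhds (h1.mem_nhds h2), O, h1, Subset.rfl, h3, h4⟩
  -- step 2: finite time
  let Xn : ℕ → Set Cyl := fun n => {z | ∀ i ≤ n, (e^[i] z).2 ≤ 0}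
  have hXn : ∀ n, IsClosed (Xn n) := by
    intro n
    have : Xn n = ⋂ i : ℕ, ⋂ _ : i ≤ n, {z | (e^[i] z).2 ≤ 0} := by ext z; simp [Xn]
    rw [this]
    exact isClosed_iInter fun i => isClosed_iInter fun _ =>
      isClosed_le (continuous_snd.comp (hit i)) continuous_const
  let D : Set Cyl := frontier O ∪ ({z | -1 ≤ z.2 ∧ z.2 ≤ 0} \ O)
  have hDc : IsCompact D := by
    refine IsCompact.union ?_ ((isCompact_band _ _).diff hO)
    refine (isCompact_band (-M1) M1).of_isClosed_subset isClosed_frontier ?_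
    have hcl : closure O ⊆ {z : Cyl | -M1 ≤ z.2 ∧ z.2 ≤ M1} :=
      closure_minimal (fun z hz => abs_le.1 (hM1 z hz)) (isCompact_band _ _).isClosed
    exact frontier_subset_closure.trans hcl
  obtain ⟨n, hn⟩ := hDc.elim_directed_family_closed Xn hXn
    (by
      rw [eq_empty_iff_forall_notMem] at *
      rintro z ⟨hz1, hz2⟩
      have hzX : z ∈ X := fun i => mem_iInter.1 hz2 i i le_rfl
      rcases hz1 with h | h
      · exact hfr z ⟨h, hzX⟩
      · exact h.2 (hQO ⟨hzX, h.1⟩))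
    (by
      intro a b
      exact ⟨max a b, fun z hz i hi => hz i (hi.trans (le_max_left _ _)),
        fun z hz i hi => hz i (hi.trans (le_max_right _ _))⟩)
  rw [eq_empty_iff_forall_notMem] at hn
  -- step 3: the component U at minus infinity
  let G : Set Cyl := {z | ∀ i ≤ n, (e^[i] z).2 < 0}
  have hG : IsOpen G := by
    have : G = ⋂ i ∈ Finset.range (n + 1), {z | (e^[i] z).2 < 0} := by
      ext z; simp [G, Nat.lt_succ_iff]
    rw [this]
    exact isOpen_biInter_finset fun i _ =>
      isOpen_lt (continuous_snd.comp (hit i)) continuous_const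
  obtain ⟨M, hMK, hMM1, hMpos⟩ : ∃ M : ℝ, n * K ≤ M ∧ |M1| ≤ M ∧ 0 ≤ M :=
    ⟨max (n * K) |M1|, le_max_left _ _, le_max_right _ _, (abs_nonneg _).trans (le_max_right _ _)⟩
  let p : Cyl := (0, -M - 1)
  let U := connectedComponentIn G p
  have hUo : IsOpen U := hG.connectedComponentIn
  have hUc : IsPreconnected U := isPreconnected_connectedComponentIn
  have hUG : U ⊆ G := connectedComponentIn_subset _ _
  have hlow : {z : Cyl | z.2 < -M} ⊆ U := by
    have hpre : IsPreconnected {z : Cyl | z.2 < -M} := by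
      have : {z : Cyl | z.2 < -M} = (univ : Set (AddCircle (1:ℝ))) ×ˢ Iio (-M) := by
        ext z; simp
      rw [this]
      exact isPreconnected_univ.prod isPreconnected_Iio
    refine hpre.subset_connectedComponentIn (by simp [p]) ?_
    intro z hz i hi
    have h1 := (abs_le.1 (iter_disp hK i z)).2
    have h2 : (i:ℝ) * K ≤ n * K := mul_le_mul_of_nonneg_right (by exact_mod_cast hi) hK0
    simp only [mem_ofPred_eq] at hz
    linarith
  have hUlow : ∀ z ∈ U, z.2 < -1 := by
    have hUO : U ⊆ (closure O)ᶜ := by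
      apply hUc.subset_of_closure_inter_subset isClosed_closure.isOpen_compl
      · have hp : p ∈ U := hlow (by simp [p])
        refine ⟨p, hp, fun hcon => ?_⟩
        have hcl : closure O ⊆ {z : Cyl | -M1 ≤ z.2 ∧ z.2 ≤ M1} :=
          closure_minimal (fun z hz => abs_le.1 (hM1 z hz)) (isCompact_band _ _).isClosed
        have := (hcl hcon).1
        simp only [p] at this
        linarith [le_abs_self M1]
      · rintro z ⟨hz1, hz2⟩ hz3
        refine hn z ⟨Or.inl ⟨hz3, fun hz4 => ?_⟩, fun i hi => (hUG hz2 i hi).le⟩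
        rw [closure_compl] at hz1
        exact hz1 (interior_mono subset_closure hz4)
    intro z hz
    by_contra hcon
    exact hn z ⟨Or.inr ⟨⟨not_lt.1 hcon, (hUG hz 0 (Nat.zero_le _)).le⟩,
      fun h => hUO hz (subset_closure h)⟩, fun i hi => (hUG hz i hi).le⟩
  -- boundary points hit level zero
  have hbd : ∀ z ∈ closure U, z ∉ U → ∃ i, 1 ≤ i ∧ i ≤ n ∧ 0 ≤ (e^[i] z).2 := by
    intro z hz hzU
    have hzlow : z.2 ≤ -1 :=
      closure_minimal (t := {z : Cyl | z.2 ≤ -1}) (fun w hw => (hUlow w hw).le)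
        (isClosed_le continuous_snd continuous_const) hz
    have hzG : z ∉ G := by
      intro hzG
      apply hzU
      have hpre : IsPreconnected (insert z U) :=
        hUc.subset_closure (subset_insert _ _) (insert_subset hz subset_closure)
      exact hpre.subset_connectedComponentIn (F := G) (x := p)
        (Or.inr (hlow (by simp [p]))) (insert_subset hzG hUG) (mem_insert _ _)
    simp only [G, mem_ofPred_eq, not_forall, not_lt] at hzG
    obtain ⟨i, hi, hi2⟩ := hzG
    refine ⟨i, ?_, hi, hi2⟩
    rcases Nat.eq_zero_or_pos i with rfl | h
    · simp at hi2; linarith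
    · exact h
  have hom : ∀ m, ∃ g : Cyl ≃ₜ Cyl, ⇑g = e^[m] := by
    intro m
    induction m with
    | zero => exact ⟨Homeomorph.refl _, rfl⟩
    | succ m ih =>
      obtain ⟨g, hg⟩ := ih
      refine ⟨g.trans e, ?_⟩
      funext z
      rw [Function.iterate_succ_apply', ← hg]; rfl
  -- U ⊆ e(U)
  have hUsub : U ⊆ e '' U := by
    apply hUc.subset_of_closure_inter_subset (e.isOpenMap _ hUo)
    · let w : Cyl := (0, -M - K - 1)
      have hw : w.2 < -M := by simp only [w]; linarith
      refine ⟨e w, hlow ?_, w, hlow hw, rfl⟩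
      have := (abs_le.1 (hK w)).2
      simp only [mem_ofPred_eq, w] at *
      linarith
    · rw [← e.image_closure]
      rintro _ ⟨⟨z, hz, rfl⟩, hez⟩
      by_cases hzU : z ∈ U
      · exact ⟨z, hzU, rfl⟩
      · exfalso
        obtain ⟨i, hi1, hi2, hi3⟩ := hbd z hz hzU
        have h1 := hUG hez (i - 1) (by omega)
        rw [← Function.iterate_succ_apply, Nat.succ_eq_add_one, Nat.sub_add_cancel hi1] at h1
        linarith
  have hback : ∀ m z, e^[m] z ∈ shv 1 '' U → z ∈ shv 1 '' U := by
    intro m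
    induction m with
    | zero => intro z hz; exact hz
    | succ m ih =>
      intro z hz
      rw [Function.iterate_succ_apply] at hz
      obtain ⟨u, hu, hu2⟩ := ih _ hz
      obtain ⟨v, hv, rfl⟩ := hUsub hu
      have h1 := hs 1 v
      simp only [Int.cast_one] at h1
      rw [← h1] at hu2
      exact ⟨v, hv, e.injective hu2⟩
  -- U + 1 ⊆ e^n (U)
  have hU1 : shv 1 '' U ⊆ e^[n] '' U := by
    obtain ⟨g, hg⟩ := hom n
    rw [← hg]
    apply (hUc.image _ (shv_cont 1).continuousOn).subset_of_closure_inter_subset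
      (g.isOpenMap _ hUo)
    · let w : Cyl := (0, -M - n * K - 2)
      have hnK : 0 ≤ n * K := by positivity
      have hw : w.2 < -M := by simp only [w]; linarith
      refine ⟨g w, ⟨shv (-1) (g w), hlow ?_, by simp [shv]⟩, w, hlow hw, rfl⟩
      have := (abs_le.1 (iter_disp hK n w)).2
      rw [hg]
      simp only [mem_ofPred_eq, w, shv] at *
      linarith
    · rw [← g.image_closure]
      rintro _ ⟨⟨z, hz, rfl⟩, hez⟩
      by_cases hzU : z ∈ U
      · exact ⟨z, hzU, rfl⟩
      · exfalso
        obtain ⟨i, hi1, hi2, hi3⟩ := hbd z hz hzU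
        rw [hg, ← Nat.sub_add_cancel hi2, Function.iterate_add_apply] at hez
        obtain ⟨u, hu, hu2⟩ := hback _ _ hez
        have h1 := hUlow u hu
        rw [← hu2] at hi3
        simp only [shv] at hi3
        linarith
  have hUj : ∀ (j : ℕ) z, e^[n * j] z ∈ shv j '' U → z ∈ U := by
    intro j
    induction j with
    | zero =>
      rintro z ⟨u, hu, hu2⟩
      have : u = z := by
        rw [show e^[n * 0] z = z from rfl] at hu2
        rw [← hu2]; simp [shv]
      exact this ▸ hu
    | succ j ih =>
      rintro z ⟨u, hu, hu2⟩
      apply ih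
      obtain ⟨v, hv, hv2⟩ := hU1 ⟨u, hu, rfl⟩
      refine ⟨v, hv, ?_⟩
      obtain ⟨g, hg⟩ := hom n
      apply g.injective
      rw [hg]
      have h1 := iter_shift hs n j v
      simp only [Int.cast_natCast] at h1
      rw [h1, hv2, ← Function.iterate_add_apply, show n + n * j = n * (j + 1) by ring, ← hu2]
      simp [shv]; ring
  -- conclusion
  obtain ⟨j, hj⟩ := exists_nat_gt (M + 2)
  refine not_unif hK0 hK h0 1 (by simp) (n * j) 1 one_pos ?_
  intro z
  obtain ⟨c, hc1, hc2⟩ := exists_rep z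
  have h1 : e^[n * j] (shv c z) ∉ shv j '' U := fun h => by
    have := hUlow _ (hUj j _ h)
    linarith
  have h2 : -M + j ≤ (e^[n * j] (shv c z)).2 := by
    by_contra hcon
    apply h1
    refine ⟨shv (-j) (e^[n * j] (shv c z)), hlow ?_, by simp [shv]⟩
    simp only [mem_ofPred_eq, shv] at *
    linarith
  rw [iter_shift hs] at h2
  simp only [shv] at *
  linarith

end Helpers

/-- If `0 ∈ ρ_V(f̂)` (so `B_S⁻ ≠ ∅`) and `ω(B_S⁻) = ∅`, then
`[−ε, 0] ⊆ ρ_V(f̂)` for some `ε > 0`. -/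
theorem empty_omega_BS_implies_interval
    (L : DehnLift) (fhat : Cyl → Cyl)
    (hfhat : ∀ z : ℝ × ℝ, projCyl (L.F z) = fhat (projCyl z))
    (hzero : (0:ℝ) ∈ rotSet fhat)
    (homega : omegaSet fhat (BS fhat) = ∅) :
    ∃ ε > (0:ℝ), Set.Icc (-ε) 0 ⊆ rotSet fhat := by
  obtain ⟨e, rfl⟩ := exists_homeo L fhat hfhat
  have hs := fhat_shift L e hfhat
  obtain ⟨K, hK0, hK⟩ := bdd_disp e.continuous hs
  obtain ⟨w, hw⟩ := BS_nonempty e hs hzero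
  have hit : ∀ n, Continuous (e^[n]) := fun n => e.continuous.iterate n
  -- uniform escape
  obtain ⟨N, hN⟩ := (isCompact_band (-2) 0).elim_directed_family_closed
    (fun n : ℕ => closure (⋃ i : ℕ, ⋃ _ : n ≤ i, e^[i] '' BS e)) (fun _ => isClosed_closure)
    (by
      change _ ∩ omegaSet e (BS e) = ∅
      rw [homega, Set.inter_empty])
    (by
      intro a b
      refine ⟨max a b, closure_mono ?_, closure_mono ?_⟩
      · exact Set.iUnion_mono fun i => Set.iUnion_mono' fun h => ⟨(le_max_left _ _).trans h, le_rfl⟩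
      · exact Set.iUnion_mono fun i => Set.iUnion_mono' fun h => ⟨(le_max_right _ _).trans h, le_rfl⟩)
  rw [Set.eq_empty_iff_forall_notMem] at hN
  have hesc : ∀ i, N ≤ i → ∀ z ∈ BS e, (e^[i] z).2 < -2 := by
    intro i hi z hz
    by_contra hcon
    refine hN (e^[i] z) ⟨⟨not_lt.1 hcon, hz.1 i⟩, subset_closure ?_⟩
    simp only [Set.mem_iUnion]
    exact ⟨i, hi, z, hz, rfl⟩
  -- one step down
  have hstep : ∀ z ∈ BS e, shv 1 (e^[N + 1] z) ∈ BS e := by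
    intro z hz
    let C := connectedComponentIn (Bminus e) z
    let S := (fun v => shv 1 (e^[N + 1] v)) '' C
    have hSpre : IsPreconnected S :=
      isPreconnected_connectedComponentIn.image _ ((shv_cont 1).comp (hit _)).continuousOn
    have hCB : ∀ v ∈ C, v ∈ BS e := by
      intro v hv
      refine ⟨connectedComponentIn_subset _ _ hv, ?_⟩
      rw [← connectedComponentIn_eq hv]
      exact hz.2
    have hSB : S ⊆ Bminus e := by
      rintro _ ⟨v, hv, rfl⟩ i
      have h1 := iter_shift hs i 1 (e^[N + 1] v)
      simp only [Int.cast_one] at h1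
      simp only
      rw [h1, ← Function.iterate_add_apply]
      have h2 := hesc (i + (N + 1)) (by omega) v (hCB v hv)
      simp only [shv]
      linarith
    have hzC : z ∈ C := mem_connectedComponentIn hz.1
    have hzS : shv 1 (e^[N + 1] z) ∈ S := ⟨z, hzC, rfl⟩
    refine ⟨hSB hzS, ?_⟩
    rintro ⟨M, hM⟩
    apply hz.2
    refine ⟨M + 1 + (N + 1 : ℕ) * K, fun v hv => ?_⟩
    have h1 := hM _ (hSpre.subset_connectedComponentIn hzS hSB ⟨v, hv, rfl⟩)
    have h2 := iter_disp hK (N + 1) v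
    simp only [shv] at h1
    rw [abs_le] at *
    constructor <;> linarith [h1.1, h1.2, h2.1, h2.2]
  have hdown : ∀ (j : ℕ) z, z ∈ BS e → (e^[(N + 1) * j] z).2 ≤ -j := by
    intro j
    induction j with
    | zero => intro z hz; simpa using hz.1 0
    | succ j ih =>
      intro z hz
      have h1 := ih _ (hstep z hz)
      have h2 := iter_shift hs ((N + 1) * j) 1 (e^[N + 1] z)
      simp only [Int.cast_one] at h2
      rw [h2, ← Function.iterate_add_apply] at h1
      rw [Nat.mul_succ]
      simp only [shv] at h1
      push_cast
      linarith
  have hNpos : (0:ℝ) < (N + 1 : ℝ) := by positivity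
  refine ⟨1 / (2 * (N + 1)), by positivity, ?_⟩
  rintro r ⟨hr1, hr2⟩
  rcases hr2.eq_or_lt with rfl | hr2
  · exact hzero
  apply Set.mem_iInter.2
  intro i
  apply subset_closure
  obtain ⟨j0, hj0⟩ := exists_nat_gt (2 * |w.2|)
  let j := j0 + i + 1
  let m := (N + 1) * j
  have him : i + 1 ≤ m := by
    have : 1 * j ≤ (N + 1) * j := Nat.mul_le_mul_right _ (by omega)
    simp only [m]; omega
  have hmpos : (0:ℝ) < m := by exact_mod_cast (by omega : 0 < m)
  have hjR : 2 * |w.2| < (j:ℝ) := by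
    simp only [j]; push_cast
    have : (0:ℝ) ≤ i := by positivity
    linarith
  have hmR : (m:ℝ) = (N + 1) * j := by simp only [m]; push_cast; ring
  have hcont : Continuous fun z : Cyl => ((e^[m] z).2 - z.2) / m := by
    have := hit m
    fun_prop
  have hlo : ((e^[m] w).2 - w.2) / m ≤ r := by
    refine le_trans ?_ hr1
    rw [div_le_iff₀ hmpos, hmR]
    have h1 := hdown j w hw
    have h2 : -(1 / (2 * ((N:ℝ) + 1))) * ((N + 1) * j) = -(j / 2) := by
      field_simp
    rw [h2]
    have h3 := neg_abs_le w.2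
    simp only [m] at *
    linarith
  obtain ⟨v, hv⟩ : ∃ v, r ≤ ((e^[m] v).2 - v.2) / m := by
    by_contra hcon
    push Not at hcon
    refine not_unif hK0 hK hzero (-1) (by simp) m (-r * m) (by nlinarith) fun z => ?_
    have := hcon z
    rw [div_lt_iff₀ hmpos] at this
    linarith
  obtain ⟨z, hz⟩ := mem_range_of_exists_le_of_exists_ge hcont ⟨w, hlo⟩ ⟨v, hv⟩
  simp only [Set.mem_iUnion, Set.mem_ofPred_eq]
  exact ⟨m, him, z, hz.symm⟩
end
end

section
/- Let f be a homeomorphism of the torus T² homotopic to a Dehn twist, with lift f̂ to the vertical cylinder A. Suppose 0 ∈ ρ_V(f̂) and ω(B_S⁻) ≠ ∅ and ω(B_N⁺) ≠ ∅. Then for every x̂ ∈ ℝ/ℤ the fiber sets {ŷ : (x̂,ŷ) ∈ ω(B_S⁻)} and {ŷ : (x̂,ŷ) ∈ ω(B_N⁺)} are nonempty, and, defining μ(x̂) = max{ŷ : (x̂,ŷ) ∈ ω(B_S⁻)} and ν(x̂) = min{ŷ : (x̂,ŷ) ∈ ω(B_N⁺)} (these maxima and minima exist), there exists a constant M_f >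 0 such that |μ(x̂) − μ(ŷ)| ≤ M_f and |ν(x̂) − ν(ŷ)| ≤ M_f for all x̂, ŷ ∈ ℝ/ℤ. -/
noncomputable section

open MeasureTheory

lemma aux_fhat_continuous (L : DehnLift) (fhat : Cyl → Cyl)
    (hfhat : ∀ z : ℝ × ℝ, projCyl (L.F z) = fhat (projCyl z)) : Continuous fhat := by
  have hq : IsOpenQuotientMap projCyl :=
    (QuotientAddGroup.isOpenQuotientMap_mk (G := ℝ)
      (N := AddSubgroup.zmultiples (1:ℝ))).prodMap (IsOpenQuotientMap.id (X := ℝ))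
  rw [← hq.continuous_comp_iff]
  have : fhat ∘ projCyl = projCyl ∘ L.F := by
    funext z; exact (hfhat z).symm
  rw [this]
  exact hq.continuous.comp L.F.continuous

/-- `F - (x + k y, y)` is bounded. -/
lemma aux_bound (L : DehnLift) : ∃ C : ℝ, 0 ≤ C ∧ ∀ x y : ℝ,
    |(L.F (x, y)).1 - (x + L.k * y)| ≤ C ∧ |(L.F (x, y)).2 - y| ≤ C := by
  let G : ℝ × ℝ → ℝ × ℝ := fun z => L.F z - (z.1 + L.k * z.2, z.2)
  have hG : Continuous G := by
    have := L.F.continuous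
    fun_prop
  have h1 : ∀ y, Function.Periodic (fun x => G (x, y)) 1 := by
    intro y x
    simp only [G, L.horiz]
    ext <;> simp <;> ring
  have h2 : ∀ x, Function.Periodic (fun y => G (x, y)) 1 := by
    intro x y
    simp only [G, L.vert]
    ext <;> simp <;> ring
  obtain ⟨C, hC⟩ := (isCompact_Icc (a := ((0:ℝ),(0:ℝ))) (b := (1,1))).exists_bound_of_continuousOn
    hG.continuousOn
  have hb : ∀ x y, ‖G (x, y)‖ ≤ C := by
    intro x y
    have e1 := (h1 y).sub_zsmul_eq (x := x) ⌊x⌋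
    have e2 := (h2 (x - ⌊x⌋ • (1:ℝ))).sub_zsmul_eq (x := y) ⌊y⌋
    rw [← e1, ← e2]
    apply hC
    simp only [zsmul_eq_mul, mul_one, Set.mem_Icc, Prod.mk_le_mk]
    refine ⟨⟨?_, ?_⟩, ?_, ?_⟩
    · linarith [Int.floor_le x]
    · linarith [Int.floor_le y]
    · linarith [Int.lt_floor_add_one x]
    · linarith [Int.lt_floor_add_one y]
  refine ⟨C, (norm_nonneg _).trans (hb 0 0), fun x y => ⟨?_, ?_⟩⟩
  · exact (norm_fst_le (G (x, y))).trans (hb x y)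
  · exact (norm_snd_le (G (x, y))).trans (hb x y)

lemma aux_omega_closed (fhat : Cyl → Cyl) (S : Set Cyl) : IsClosed (omegaSet fhat S) :=
  isClosed_iInter fun _ => isClosed_closure

lemma aux_omega_inv (fhat : Cyl → Cyl) (hc : Continuous fhat) (S : Set Cyl) (z : Cyl)
    (hz : z ∈ omegaSet fhat S) : fhat z ∈ omegaSet fhat S := by
  simp only [omegaSet, Set.mem_iInter] at hz ⊢
  intro n
  have h := image_closure_subset_closure_image hc (Set.mem_image_of_mem fhat (hz n))
  refine closure_mono ?_ h
  rintro _ ⟨w, hw, rfl⟩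
  simp only [Set.mem_iUnion] at hw ⊢
  obtain ⟨i, hi, s, hs, rfl⟩ := hw
  exact ⟨i + 1, by omega, s, hs, Function.iterate_succ_apply' fhat i s⟩

lemma aux_omega_le (fhat : Cyl → Cyl) (ε : ℝ) (S : Set Cyl)
    (hle : ∀ z ∈ S, ∀ n : ℕ, ε * (fhat^[n] z).2 ≤ 0) (n : ℕ) (z : Cyl)
    (hz : z ∈ closure (⋃ i : ℕ, ⋃ _ : n ≤ i, fhat^[i] '' S)) : ε * z.2 ≤ 0 := by
  have hcl : IsClosed {z : Cyl | ε * z.2 ≤ 0} :=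
    isClosed_le (by fun_prop) (by fun_prop)
  refine closure_minimal ?_ hcl hz
  intro w hw
  simp only [Set.mem_iUnion] at hw
  obtain ⟨i, hi, s, hs, rfl⟩ := hw
  exact hle s hs i

/-- Connected pieces of the omega-limit reaching height `-M`. -/
lemma aux_component (fhat : Cyl → Cyl) (hc : Continuous fhat) (C : ℝ)
    (hC : ∀ z, |(fhat z).2 - z.2| ≤ C) (ε : ℝ) (hε : |ε| = 1) (S : Set Cyl)
    (hle : ∀ z ∈ S, ∀ n : ℕ, ε * (fhat^[n] z).2 ≤ 0)
    (hun : ∀ z ∈ S, ∃ D ⊆ S, IsPreconnected D ∧ z ∈ D ∧ ∀ M : ℝ, ∃ w ∈ D, ε * w.2 < -M)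
    (z : Cyl) (hz : z ∈ omegaSet fhat S) (M : ℝ) (hM : -M ≤ ε * z.2) :
    ∃ Q ⊆ omegaSet fhat S, IsPreconnected Q ∧ z ∈ Q ∧ (∀ q ∈ Q, -M ≤ ε * q.2) ∧
      ∃ q ∈ Q, ε * q.2 ≤ -M := by
  have hεε : ε * ε = 1 := by
    have := abs_mul_abs_self ε
    rw [hε] at this; linarith
  let X : ℕ → Set Cyl := fun n =>
    closure (⋃ i : ℕ, ⋃ _ : n ≤ i, fhat^[i] '' S) ∩ {w | -M ≤ ε * w.2}
  have hclM : IsClosed {w : Cyl | -M ≤ ε * w.2} := isClosed_le (by fun_prop) (by fun_prop)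
  have hXc : ∀ n, IsCompact (X n) := by
    intro n
    have hK : IsCompact ((Set.univ : Set (AddCircle (1:ℝ))) ×ˢ Set.Icc (-|M|) |M|) :=
      isCompact_univ.prod isCompact_Icc
    refine hK.of_isClosed_subset (isClosed_closure.inter hclM) ?_
    rintro w ⟨hw1, hw2⟩
    have h1 := aux_omega_le fhat ε S hle n w hw1
    have h2 : -M ≤ ε * w.2 := hw2
    refine ⟨Set.mem_univ _, abs_le.1 ?_⟩
    have : |w.2| = |ε * w.2| := by rw [abs_mul, hε, one_mul]
    rw [this, abs_of_nonpos h1]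
    linarith [le_abs_self M]
  have hXanti : Antitone X := by
    intro m n hmn
    refine Set.inter_subset_inter_left _ (closure_mono ?_)
    intro w hw
    simp only [Set.mem_iUnion] at hw ⊢
    obtain ⟨i, hi, h⟩ := hw
    exact ⟨i, hmn.trans hi, h⟩
  let K : Set Cyl := omegaSet fhat S ∩ {w | -M ≤ ε * w.2}
  have hKX : K = ⋂ n, X n := by
    simp only [K, X, omegaSet, Set.iInter_inter]
  have hKc : IsCompact K := by
    refine (hXc 0).of_isClosed_subset ((aux_omega_closed fhat S).inter hclM) ?_
    change K ⊆ X 0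
    rw [hKX]; exact Set.iInter_subset _ 0
  have hzK : z ∈ K := ⟨hz, hM⟩
  refine ⟨connectedComponentIn K z, (connectedComponentIn_subset K z).trans Set.inter_subset_left,
    isPreconnected_connectedComponentIn, mem_connectedComponentIn hzK,
    fun q hq => (connectedComponentIn_subset K z hq).2, ?_⟩
  by_contra! hcon
  have : CompactSpace K := isCompact_iff_compactSpace.1 hKc
  -- a clopen piece
  obtain ⟨Z, hZclopen, hzZ, hZE⟩ : ∃ Z : Set K, IsClopen Z ∧ (⟨z, hzK⟩ : K) ∈ Z ∧
      ∀ w ∈ Z, -M < ε * w.1.2 := by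
    have hopen : IsOpen {w : K | -M < ε * w.1.2} := isOpen_lt (by fun_prop) (by fun_prop)
    have : Nonempty {s : Set K // IsClopen s ∧ (⟨z, hzK⟩ : K) ∈ s} :=
      ⟨⟨Set.univ, isClopen_univ, Set.mem_univ _⟩⟩
    obtain ⟨s, hs⟩ := exists_subset_nhds_of_compactSpace
      (V := fun s : {s : Set K // IsClopen s ∧ (⟨z, hzK⟩ : K) ∈ s} => s.1)
      (U := {w : K | -M < ε * w.1.2})
      (by
        intro a b
        exact ⟨⟨a.1 ∩ b.1, a.2.1.inter b.2.1, a.2.2, b.2.2⟩,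
          Set.inter_subset_left, Set.inter_subset_right⟩)
      (fun s => s.2.1.isClosed)
      (by
        intro w hw
        rw [← connectedComponent_eq_iInter_isClopen] at hw
        refine hopen.mem_nhds (hcon w.1 ?_)
        rw [connectedComponentIn_eq_image hzK]
        exact Set.mem_image_of_mem _ hw)
    exact ⟨s.1, s.2.1, s.2.2, fun w hw => hs hw⟩
  have hdisj : Disjoint (Subtype.val '' Z : Set Cyl) (Subtype.val '' Zᶜ) :=
    Set.disjoint_image_of_injective Subtype.val_injective disjoint_compl_right
  obtain ⟨O, P, hO, hP, hZO, hZP, hOP⟩ := SeparatedNhds.of_isCompact_isCompact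
    (hZclopen.isClosed.isCompact.image continuous_subtype_val)
    (hZclopen.compl.isClosed.isCompact.image continuous_subtype_val) hdisj
  have hgt : IsOpen {w : Cyl | -M < ε * w.2} := isOpen_lt (by fun_prop) (by fun_prop)
  have hlt : IsOpen {w : Cyl | ε * w.2 < -M} := isOpen_lt (by fun_prop) (by fun_prop)
  let O' : Set Cyl := O ∩ {w | -M < ε * w.2}
  have hO' : IsOpen O' := hO.inter hgt
  have hzO' : z ∈ O' := ⟨hZO ⟨_, hzZ, rfl⟩, hZE _ hzZ⟩
  obtain ⟨n, hn⟩ := exists_subset_nhds_of_isCompact (V := X) (U := O' ∪ P)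
    hXanti.directed_ge hXc (by
      intro w hw
      rw [← hKX] at hw
      refine (hO'.union hP).mem_nhds ?_
      by_cases h : (⟨w, hw⟩ : K) ∈ Z
      · exact Or.inl ⟨hZO ⟨_, h, rfl⟩, hZE _ h⟩
      · exact Or.inr (hZP ⟨⟨w, hw⟩, h, rfl⟩))
  have hzn := Set.mem_iInter.1 hz n
  obtain ⟨w, hwO, hw⟩ := mem_closure_iff.1 hzn O' hO' hzO'
  simp only [Set.mem_iUnion] at hw
  obtain ⟨i, hi, s, hs, rfl⟩ := hw
  obtain ⟨D, hDS, hDc, hsD, hDun⟩ := hun s hs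
  have hEc : IsPreconnected (fhat^[i] '' D) := hDc.image _ (hc.iterate i).continuousOn
  have hcover : fhat^[i] '' D ⊆ O' ∪ (P ∪ {w | ε * w.2 < -M}) := by
    rintro _ ⟨d, hd, rfl⟩
    by_cases h : ε * (fhat^[i] d).2 < -M
    · exact Or.inr (Or.inr h)
    · have : fhat^[i] d ∈ X n := by
        refine ⟨subset_closure ?_, not_lt.1 h⟩
        simp only [Set.mem_iUnion]
        exact ⟨i, hi, d, hDS hd, rfl⟩
      rcases hn this with h | h
      · exact Or.inl h
      · exact Or.inr (Or.inl h)
  have hdis : Disjoint O' (P ∪ {w | ε * w.2 < -M}) := by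
    rw [Set.disjoint_left]
    rintro a ⟨ha1, ha2⟩ (h | h)
    · exact Set.disjoint_left.1 hOP ha1 h
    · exact lt_asymm (show -M < ε * a.2 from ha2) (show ε * a.2 < -M from h)
  have hsub := hEc.subset_left_of_subset_union hO' (hP.union hlt) hdis hcover
    ⟨_, Set.mem_image_of_mem _ hsD, hwO⟩
  have hiter : ∀ (j : ℕ) (d : Cyl), |(fhat^[j] d).2 - d.2| ≤ j * C := by
    intro j d
    induction j with
    | zero => simp
    | succ j ih =>
      rw [Function.iterate_succ_apply']
      have h1 := hC (fhat^[j] d)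
      push_cast
      calc |(fhat (fhat^[j] d)).2 - d.2|
          ≤ |(fhat (fhat^[j] d)).2 - (fhat^[j] d).2| + |(fhat^[j] d).2 - d.2| :=
            abs_sub_le _ _ _
        _ ≤ (j + 1) * C := by linarith
  obtain ⟨d, hd, hdlt⟩ := hDun (M + i * C)
  have h1 : -M < ε * (fhat^[i] d).2 := (hsub (Set.mem_image_of_mem _ hd)).2
  have h2 : |ε * ((fhat^[i] d).2 - d.2)| ≤ i * C := by
    rw [abs_mul, hε, one_mul]; exact hiter i d
  have h3 := (abs_le.1 h2).2
  rw [mul_sub] at h3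
  linarith

/-- Every fiber meets the omega limit at uniformly bounded height. -/
lemma aux_main (L : DehnLift) (fhat : Cyl → Cyl)
    (hfhat : ∀ z : ℝ × ℝ, projCyl (L.F z) = fhat (projCyl z))
    (ε : ℝ) (hε : |ε| = 1) (S : Set Cyl)
    (hle : ∀ z ∈ S, ∀ n : ℕ, ε * (fhat^[n] z).2 ≤ 0)
    (hun : ∀ z ∈ S, ∃ D ⊆ S, IsPreconnected D ∧ z ∈ D ∧ ∀ M : ℝ, ∃ w ∈ D, ε * w.2 < -M)
    (hne : (omegaSet fhat S).Nonempty) :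
    ∃ M : ℝ, ∀ x : AddCircle (1:ℝ), ∃ y : ℝ, (x, y) ∈ omegaSet fhat S ∧ -M ≤ ε * y := by
  have hc := aux_fhat_continuous L fhat hfhat
  obtain ⟨C, hC0, hCb⟩ := aux_bound L
  have hC : ∀ z, |(fhat z).2 - z.2| ≤ C := by
    rintro ⟨x, y⟩
    obtain ⟨a, rfl⟩ := QuotientAddGroup.mk_surjective x
    have h := hfhat (a, y)
    have h2 := congrArg Prod.snd h
    have h3 := (hCb a y).2
    change (L.F (a, y)).2 = (fhat ((a : AddCircle (1:ℝ)), y)).2 at h2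
    rw [h2] at h3
    exact h3
  obtain ⟨z, hz⟩ := hne
  have hεz : |ε * z.2| = |z.2| := by rw [abs_mul, hε, one_mul]
  let M : ℝ := |z.2| + 2 * C + 2
  have hMz : -M ≤ ε * z.2 := by
    have := neg_abs_le (ε * z.2)
    simp only [M]; linarith
  obtain ⟨Q, hQω, hQc, hzQ, hQM, q, hqQ, hq⟩ :=
    aux_component fhat hc C hC ε hε S hle hun z hz M hMz
  by_cases hall : ∀ x : AddCircle (1:ℝ), ∃ y, (x, y) ∈ Q
  · refine ⟨M, fun x => ?_⟩
    obtain ⟨y, hy⟩ := hall x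
    exact ⟨y, hQω hy, hQM _ hy⟩
  push Not at hall
  obtain ⟨x₀, hx₀⟩ := hall
  obtain ⟨a, rfl⟩ := QuotientAddGroup.mk_surjective x₀
  let s : Cyl → ℝ × ℝ := fun w => ((AddCircle.equivIco 1 a w.1 : ℝ), w.2)
  have hsproj : ∀ w, projCyl (s w) = w := by
    intro w
    exact Prod.ext AddCircle.coe_equivIco rfl
  have hscont : ContinuousOn s Q := by
    intro w hw
    have hwa : w.1 ≠ (a : AddCircle (1:ℝ)) := by
      intro h
      exact hx₀ w.2 (by rw [← show w.1 = _ from h]; exact hw)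
    have h1 : ContinuousAt (fun w : Cyl => ((AddCircle.equivIco 1 a w.1 : ℝ))) w :=
      continuousAt_subtype_val.comp
        ((AddCircle.continuousAt_equivIco 1 a hwa).comp continuousAt_fst)
    exact (h1.prodMk continuousAt_snd).continuousWithinAt
  let g : Cyl → ℝ := fun w => (L.F (s w)).1
  have hgcont : ContinuousOn g Q :=
    (continuous_fst.comp L.F.continuous).comp_continuousOn hscont
  have hI : IsPreconnected (g '' Q) := hQc.image g hgcont
  -- values of `g`
  have hgb : ∀ w, |g w - ((s w).1 + L.k * w.2)| ≤ C := fun w => (hCb _ _).1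
  have hsI : ∀ w, a ≤ (s w).1 ∧ (s w).1 < a + 1 := fun w => (AddCircle.equivIco 1 a w.1).2
  have hk : (1:ℝ) ≤ L.k := by exact_mod_cast L.k_pos
  have hwidth : 1 ≤ |g z - g q| := by
    have hzq : 2 * C + 2 ≤ |z.2 - q.2| := by
      have h1 : |z.2 - q.2| = |ε * z.2 - ε * q.2| := by
        rw [← mul_sub, abs_mul, hε, one_mul]
      rw [h1]
      have h2 := le_abs_self (ε * z.2 - ε * q.2)
      have h3 := neg_abs_le (ε * z.2)
      simp only [M] at hq
      linarith
    have h4 : 2 * C + 2 ≤ |(L.k : ℝ) * (z.2 - q.2)| := by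
      rw [abs_mul, abs_of_pos (by linarith : (0:ℝ) < L.k)]
      nlinarith [abs_nonneg (z.2 - q.2)]
    have e1 := abs_le.1 (hgb z)
    have e2 := abs_le.1 (hgb q)
    have e3 := hsI z
    have e4 := hsI q
    rcases le_abs.1 h4 with h | h
    · refine le_trans ?_ (le_abs_self _)
      linarith [e1.1, e1.2, e2.1, e2.2, e3.1, e3.2, e4.1, e4.2]
    · refine le_trans ?_ (neg_le_abs _)
      linarith [e1.1, e1.2, e2.1, e2.2, e3.1, e3.2, e4.1, e4.2]
  obtain ⟨c, hcI⟩ : ∃ c, Set.Icc c (c + 1) ⊆ g '' Q := by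
    have hoc := hI.ordConnected
    have hz' : g z ∈ g '' Q := ⟨z, hzQ, rfl⟩
    have hq' : g q ∈ g '' Q := ⟨q, hqQ, rfl⟩
    rcases le_abs.1 hwidth with h | h
    · exact ⟨g q, (Set.Icc_subset_Icc_right (by linarith)).trans (hoc.out hq' hz')⟩
    · exact ⟨g z, (Set.Icc_subset_Icc_right (by linarith)).trans (hoc.out hz' hq')⟩
  refine ⟨M + C, fun x => ?_⟩
  obtain ⟨w, hwQ, hw⟩ := hcI (Set.Ico_subset_Icc_self (AddCircle.equivIco 1 c x).2)
  have hF : projCyl (L.F (s w)) = fhat w := by rw [hfhat, hsproj]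
  have hx : (fhat w).1 = x := by
    rw [← hF]
    change ((g w : ℝ) : AddCircle (1:ℝ)) = x
    rw [hw]
    exact AddCircle.coe_equivIco
  refine ⟨(fhat w).2, ?_, ?_⟩
  · rw [← hx]
    exact aux_omega_inv fhat hc S w (hQω hwQ)
  · have h2 : |ε * ((fhat w).2 - w.2)| ≤ C := by
      rw [abs_mul, hε, one_mul]; exact hC w
    have h3 := (abs_le.1 h2).1
    have h4 := hQM w hwQ
    rw [mul_sub] at h3
    linarith

lemma aux_BS (fhat : Cyl → Cyl) : ∀ z ∈ BS fhat, ∃ D ⊆ BS fhat, IsPreconnected D ∧ z ∈ D ∧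
    ∀ M : ℝ, ∃ w ∈ D, (1:ℝ) * w.2 < -M := by
  rintro z ⟨hz, hzu⟩
  refine ⟨connectedComponentIn (Bminus fhat) z, ?_, isPreconnected_connectedComponentIn,
    mem_connectedComponentIn hz, ?_⟩
  · intro w hw
    exact ⟨connectedComponentIn_subset _ _ hw, by rwa [← connectedComponentIn_eq hw]⟩
  · intro M
    by_contra! h
    refine hzu ⟨M, fun w hw => ?_⟩
    have h0 : w.2 ≤ 0 := connectedComponentIn_subset _ _ hw 0
    rw [abs_of_nonpos h0]
    linarith [h w hw]

lemma aux_BN (fhat : Cyl → Cyl) : ∀ z ∈ BN fhat, ∃ D ⊆ BN fhat, IsPreconnected D ∧ z ∈ D ∧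
    ∀ M : ℝ, ∃ w ∈ D, (-1:ℝ) * w.2 < -M := by
  rintro z ⟨hz, hzu⟩
  refine ⟨connectedComponentIn (Bplus fhat) z, ?_, isPreconnected_connectedComponentIn,
    mem_connectedComponentIn hz, ?_⟩
  · intro w hw
    exact ⟨connectedComponentIn_subset _ _ hw, by rwa [← connectedComponentIn_eq hw]⟩
  · intro M
    by_contra! h
    refine hzu ⟨M, fun w hw => ?_⟩
    have h0 : 0 ≤ w.2 := connectedComponentIn_subset _ _ hw 0
    rw [abs_of_nonneg h0]
    linarith [h w hw]

/-- If `0 ∈ ρ_V(f̂)` and both `ω(B_S⁻)` and `ω(B_N⁺)` are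
nonempty, then every vertical fiber meets both sets, the functions
`μ(x̂) = max{ŷ : (x̂,ŷ) ∈ ω(B_S⁻)}` and `ν(x̂) = min{ŷ : (x̂,ŷ) ∈ ω(B_N⁺)}`
are well defined, and their oscillations are bounded by a constant `M_f > 0`. -/
theorem mu_nu_well_defined_and_uniformly_bounded
    (L : DehnLift) (fhat : Cyl → Cyl)
    (hfhat : ∀ z : ℝ × ℝ, projCyl (L.F z) = fhat (projCyl z))
    (hzero : (0:ℝ) ∈ rotSet fhat)
    (hS : (omegaSet fhat (BS fhat)).Nonempty)
    (hN : (omegaSet fhat (BN fhat)).Nonempty) :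
    (∀ x : AddCircle (1:ℝ), {y : ℝ | (x, y) ∈ omegaSet fhat (BS fhat)}.Nonempty) ∧
    (∀ x : AddCircle (1:ℝ), {y : ℝ | (x, y) ∈ omegaSet fhat (BN fhat)}.Nonempty) ∧
    ∃ Mf > (0:ℝ), ∃ μ ν : AddCircle (1:ℝ) → ℝ,
      (∀ x, IsGreatest {y : ℝ | (x, y) ∈ omegaSet fhat (BS fhat)} (μ x)) ∧
      (∀ x, IsLeast {y : ℝ | (x, y) ∈ omegaSet fhat (BN fhat)} (ν x)) ∧
      (∀ x y : AddCircle (1:ℝ), |μ x - μ y| ≤ Mf ∧ |ν x - ν y| ≤ Mf) := by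
  have hleS : ∀ z ∈ BS fhat, ∀ n : ℕ, (1:ℝ) * (fhat^[n] z).2 ≤ 0 := by
    intro z hz n
    rw [one_mul]; exact hz.1 n
  have hleN : ∀ z ∈ BN fhat, ∀ n : ℕ, (-1:ℝ) * (fhat^[n] z).2 ≤ 0 := by
    intro z hz n
    have : 0 ≤ (fhat^[n] z).2 := hz.1 n
    linarith
  obtain ⟨MS, hMS⟩ := aux_main L fhat hfhat 1 (by simp) (BS fhat) hleS (aux_BS fhat) hS
  obtain ⟨MN, hMN⟩ := aux_main L fhat hfhat (-1) (by simp) (BN fhat) hleN (aux_BN fhat) hN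
  have hupS : ∀ x y, (x, y) ∈ omegaSet fhat (BS fhat) → y ≤ 0 := by
    intro x y h
    have := aux_omega_le fhat 1 (BS fhat) hleS 0 (x, y) (Set.mem_iInter.1 h 0)
    simpa using this
  have hloN : ∀ x y, (x, y) ∈ omegaSet fhat (BN fhat) → 0 ≤ y := by
    intro x y h
    have := aux_omega_le fhat (-1) (BN fhat) hleN 0 (x, y) (Set.mem_iInter.1 h 0)
    simpa using this
  have hneS : ∀ x : AddCircle (1:ℝ), {y : ℝ | (x, y) ∈ omegaSet fhat (BS fhat)}.Nonempty :=
    fun x => let ⟨y, hy, _⟩ := hMS x; ⟨y, hy⟩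
  have hneN : ∀ x : AddCircle (1:ℝ), {y : ℝ | (x, y) ∈ omegaSet fhat (BN fhat)}.Nonempty :=
    fun x => let ⟨y, hy, _⟩ := hMN x; ⟨y, hy⟩
  have hgS : ∀ x : AddCircle (1:ℝ), IsGreatest {y : ℝ | (x, y) ∈ omegaSet fhat (BS fhat)}
      (sSup {y : ℝ | (x, y) ∈ omegaSet fhat (BS fhat)}) := by
    intro x
    have hb : BddAbove {y : ℝ | (x, y) ∈ omegaSet fhat (BS fhat)} := ⟨0, fun y hy => hupS x y hy⟩
    have hcl : IsClosed {y : ℝ | (x, y) ∈ omegaSet fhat (BS fhat)} :=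
      (aux_omega_closed fhat (BS fhat)).preimage (by fun_prop : Continuous fun y : ℝ => (x, y))
    exact ⟨hcl.csSup_mem (hneS x) hb, fun y hy => le_csSup hb hy⟩
  have hlN : ∀ x : AddCircle (1:ℝ), IsLeast {y : ℝ | (x, y) ∈ omegaSet fhat (BN fhat)}
      (sInf {y : ℝ | (x, y) ∈ omegaSet fhat (BN fhat)}) := by
    intro x
    have hb : BddBelow {y : ℝ | (x, y) ∈ omegaSet fhat (BN fhat)} := ⟨0, fun y hy => hloN x y hy⟩
    have hcl : IsClosed {y : ℝ | (x, y) ∈ omegaSet fhat (BN fhat)} :=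
      (aux_omega_closed fhat (BN fhat)).preimage (by fun_prop : Continuous fun y : ℝ => (x, y))
    exact ⟨hcl.csInf_mem (hneN x) hb, fun y hy => csInf_le hb hy⟩
  refine ⟨hneS, hneN, |MS| + |MN| + 1, by positivity, _, _, hgS, hlN, fun x y => ⟨?_, ?_⟩⟩
  · have key : ∀ x, -MS ≤ sSup {y : ℝ | (x, y) ∈ omegaSet fhat (BS fhat)} ∧
        sSup {y : ℝ | (x, y) ∈ omegaSet fhat (BS fhat)} ≤ 0 := by
      intro x
      obtain ⟨y, hy, hyM⟩ := hMS x
      have := (hgS x).2 hy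
      exact ⟨by linarith, hupS x _ (hgS x).1⟩
    have h1 := key x
    have h2 := key y
    have h3 := le_abs_self MS
    have h4 := abs_nonneg MN
    rw [abs_le]
    constructor <;> linarith [h1.1, h1.2, h2.1, h2.2]
  · have key : ∀ x, sInf {y : ℝ | (x, y) ∈ omegaSet fhat (BN fhat)} ≤ MN ∧
        0 ≤ sInf {y : ℝ | (x, y) ∈ omegaSet fhat (BN fhat)} := by
      intro x
      obtain ⟨y, hy, hyM⟩ := hMN x
      have := (hlN x).2 hy
      exact ⟨by linarith, hloN x _ (hlN x).1⟩
    have h1 := key x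
    have h2 := key y
    have h3 := le_abs_self MN
    have h4 := abs_nonneg MS
    rw [abs_le]
    constructor <;> linarith [h1.1, h1.2, h2.1, h2.2]
end
end

section
/- Let f be a homeomorphism of the torus T² homotopic to a Dehn twist, with lifts f̃ : ℝ² → ℝ² and f̂ to the vertical cylinder. If ρ_V(f̂) = {0}, then there exists a real number M′ > 0 such that for every x̃ ∈ ℝ and every integer n > 0: f̃ⁿ({x̃} × [M′, +∞)) ∩ ({x̃} × [M′, +∞)) = ∅ and f̃ⁿ({x̃} × (−∞, −M′]) ∩ ({x̃} × (−∞, −M′]) = ∅; that is, every vertical half-line sufficiently far from the zero section is free under all positive iterates of f̃. -/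
noncomputable section

open MeasureTheory

/-- A closed set such that its union with the point at infinity is connected. -/
def QProp {X : Type*} [TopologicalSpace X] (A : Set X) : Prop :=
  IsClosed A ∧ ∀ D : Set X, D ⊆ A → IsCompact D → IsClosed (A \ D) → D = ∅

theorem QProp.of_connected {X : Type*} [TopologicalSpace X] [T2Space X] {A : Set X}
    (hc : IsClosed A) (hp : IsPreconnected A) (hn : ¬ IsCompact A) : QProp A := by
  refine ⟨hc, fun D hD hDc hcl => ?_⟩
  by_contra hne
  have hne' : D.Nonempty := Set.nonempty_iff_ne_empty.mpr hne
  by_cases h : (A \ D).Nonempty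
  · have := (isPreconnected_closed_iff.mp hp) D (A \ D) hDc.isClosed hcl
      (fun x hx => by by_cases hxD : x ∈ D <;> simp [hxD, hx])
      (by obtain ⟨x, hx⟩ := hne'; exact ⟨x, hD hx, hx⟩)
      (by obtain ⟨x, hx⟩ := h; exact ⟨x, hx.1, hx⟩)
    obtain ⟨x, _, hx1, hx2⟩ := this
    exact hx2.2 hx1
  · apply hn
    have : A = D := by
      apply Set.Subset.antisymm _ hD
      intro x hx
      by_contra hxD
      exact h ⟨x, hx, hxD⟩
    rw [this]; exact hDc

theorem QProp.image {X Y : Type*} [TopologicalSpace X] [TopologicalSpace Y] (e : X ≃ₜ Y)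
    {A : Set X} (h : QProp A) : QProp (e '' A) := by
  refine ⟨e.isClosedMap _ h.1, fun D hD hDc hcl => ?_⟩
  have h1 := h.2 (e ⁻¹' D) (by
      intro x hx
      obtain ⟨y, hy, hyx⟩ := hD hx
      rwa [← e.injective hyx])
    (e.isCompact_preimage.mpr hDc) (by
      have : A \ e ⁻¹' D = e ⁻¹' (e '' A \ D) := by
        rw [Set.preimage_sdiff, e.injective.preimage_image]
      rw [this]; exact hcl.preimage e.continuous)
  rw [← Set.image_preimage_eq D e.surjective, h1, Set.image_empty]

theorem QProp.iInter {X : Type*} [MetricSpace X] [ProperSpace X] {A : ℕ → Set X}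
    (hanti : Antitone A) (h : ∀ n, QProp (A n)) : QProp (⋂ n, A n) := by
  refine ⟨isClosed_iInter fun n => (h n).1, fun D hD hDc hcl => ?_⟩
  have hdisj : Disjoint D ((⋂ n, A n) \ D) := Set.disjoint_sdiff_right
  obtain ⟨δ, hδ, hth⟩ := hDc.exists_cthickening_subset_open hcl.isOpen_compl
    (Set.subset_compl_iff_disjoint_right.mpr hdisj)
  set U := Metric.thickening δ D with hU
  have hUo : IsOpen U := Metric.isOpen_thickening
  have hDU : D ⊆ U := Metric.self_subset_thickening hδ D
  have hclU : closure U ⊆ Metric.cthickening δ D := Metric.closure_thickening_subset_cthickening δ D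
  have hcomp : IsCompact (closure U) :=
    (hDc.cthickening).of_isClosed_subset isClosed_closure hclU
  have hbd : IsCompact (closure U \ U) := hcomp.diff hUo
  have hex : ∃ n, (closure U \ U) ∩ A n = ∅ := by
    by_contra hcon
    push Not at hcon
    obtain ⟨x, hx⟩ := IsCompact.nonempty_iInter_of_sequence_nonempty_isCompact_isClosed
      (fun n => (closure U \ U) ∩ A n)
      (fun n => Set.inter_subset_inter_right _ (hanti (Nat.le_succ n)))
      (fun n => hcon n)
      (hbd.inter_right (h 0).1) (fun n => hbd.isClosed.inter (h n).1)
    rw [Set.mem_iInter] at hx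
    have hxA : x ∈ ⋂ n, A n := Set.mem_iInter.mpr fun n => (hx n).2
    have hx1 := (hx 0).1
    have := hth (hclU hx1.1)
    apply this
    exact ⟨hxA, fun hxD => hx1.2 (hDU hxD)⟩
  obtain ⟨n, hn⟩ := hex
  have heq : A n ∩ U = A n ∩ closure U := by
    apply Set.Subset.antisymm (Set.inter_subset_inter_right _ subset_closure)
    rintro x ⟨hx, hxU⟩
    refine ⟨hx, ?_⟩
    by_contra hxn
    have : x ∈ (closure U \ U) ∩ A n := ⟨⟨hxU, hxn⟩, hx⟩
    rw [hn] at this; exact this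
  have h0 := (h n).2 (A n ∩ U) Set.inter_subset_left
    (by rw [heq]; exact hcomp.inter_left (h n).1)
    (by rw [Set.sdiff_self_inter]; exact (h n).1.sdiff hUo)
  rw [Set.eq_empty_iff_forall_notMem] at h0 ⊢
  intro x hx
  exact h0 x ⟨Set.mem_iInter.mp (hD hx) n, hDU hx⟩

theorem log_lemma {K W : Set ℂ} (hK : QProp K) {p : ℂ} (hp : p ∈ K) (hW : IsCompact W)
    (hWK : W ⊆ Kᶜ) :
    ∃ g : ℂ → ℂ, ContinuousOn g W ∧ ∀ z ∈ W, Complex.exp (g z) = z - p := by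
  obtain ⟨δ, hδ, hth⟩ := hW.exists_cthickening_subset_open hK.1.isOpen_compl hWK
  have hdist : ∀ z ∈ W, ∀ q ∈ K, δ ≤ ‖z - q‖ := by
    intro z hz q hq
    by_contra hlt
    push Not at hlt
    have : q ∈ Metric.cthickening δ W := Metric.thickening_subset_cthickening _ _
      (Metric.mem_thickening_iff.mpr ⟨z, hz, by rwa [dist_comm, dist_eq_norm]⟩)
    exact hth this hq
  have hne : ∀ z ∈ W, ∀ q ∈ K, z - q ≠ 0 := by
    intro z hz q hq h0
    have := hdist z hz q hq
    rw [h0, norm_zero] at this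
    linarith
  set Ch : Set ℂ := {q | q ∈ K ∧ ∃ g : ℂ → ℂ, ContinuousOn g W ∧
    ∀ z ∈ W, Complex.exp (g z) = (z - p) / (z - q)} with hCh
  have step : ∀ q ∈ Ch, ∀ q' ∈ K, ‖q' - q‖ < δ → q' ∈ Ch := by
    rintro q ⟨hq, g, hg, hge⟩ q' hq' hlt
    have hn : ∀ z ∈ W, ‖(q' - q) / (z - q')‖ < 1 := by
      intro z hz
      rw [norm_div, div_lt_one (norm_pos_iff.mpr (hne z hz q' hq'))]
      exact lt_of_lt_of_le hlt (hdist z hz q' hq')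
    have hs : ∀ z ∈ W, 1 + (q' - q) / (z - q') ∈ Complex.slitPlane := fun z hz =>
      Complex.mem_slitPlane_of_norm_lt_one (hn z hz)
    refine ⟨hq', fun z => g z + Complex.log (1 + (q' - q) / (z - q')), ?_, ?_⟩
    · apply hg.add
      apply ContinuousOn.clog _ hs
      apply continuousOn_const.add
      apply continuousOn_const.div (by fun_prop)
      intro z hz; exact hne z hz q' hq'
    · intro z hz
      rw [Complex.exp_add, hge z hz, Complex.exp_log (Complex.slitPlane_ne_zero (hs z hz))]
      have h1 := hne z hz q hq
      have h2 := hne z hz q' hq'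
      field_simp
      ring
  have hsub : Ch ⊆ K := fun q hq => hq.1
  have hcl1 : IsClosed Ch := by
    apply isClosed_of_closure_subset
    intro x hx
    have hxK : x ∈ K := hK.1.closure_subset_iff.mpr hsub hx
    obtain ⟨q, hq, hd⟩ := Metric.mem_closure_iff.mp hx δ hδ
    exact step q hq x hxK (by rwa [← dist_eq_norm])
  have hcl2 : IsClosed (K \ Ch) := by
    apply isClosed_of_closure_subset
    intro x hx
    have hxK : x ∈ K := hK.1.closure_subset_iff.mpr Set.sdiff_subset hx
    refine ⟨hxK, fun hxC => ?_⟩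
    obtain ⟨q, hq, hd⟩ := Metric.mem_closure_iff.mp hx δ hδ
    exact hq.2 (step x hxC q hq.1 (by rwa [← dist_eq_norm, dist_comm]))
  have hpC : p ∈ Ch := by
    refine ⟨hp, fun _ => 0, continuousOn_const, fun z hz => ?_⟩
    rw [Complex.exp_zero, div_self (hne z hz p hp)]
  obtain ⟨R, hR⟩ := hW.isBounded.subset_closedBall 0
  have hex : ∃ q ∈ Ch, max R 0 < ‖q‖ := by
    by_contra hcon
    push Not at hcon
    have hb : Ch ⊆ Metric.closedBall 0 (max R 0) := fun q hq => by
      rw [mem_closedBall_zero_iff]; exact hcon q hq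
    have hcomp : IsCompact Ch := (isCompact_closedBall 0 (max R 0)).of_isClosed_subset hcl1 hb
    have := hK.2 Ch hsub hcomp hcl2
    rw [this] at hpC
    exact hpC
  obtain ⟨q, ⟨hq, g, hg, hge⟩, hlt⟩ := hex
  have hq0 : q ≠ 0 := by
    intro h; rw [h, norm_zero] at hlt
    exact absurd hlt (not_lt.mpr (le_max_right _ _))
  have hs : ∀ z ∈ W, 1 + -(z / q) ∈ Complex.slitPlane := fun z hz => by
    apply Complex.mem_slitPlane_of_norm_lt_one
    rw [norm_neg, norm_div, div_lt_one (norm_pos_iff.mpr hq0)]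
    have := mem_closedBall_zero_iff.mp (hR hz)
    exact lt_of_le_of_lt (this.trans (le_max_left _ _)) hlt
  refine ⟨fun z => g z + Complex.log (-q) + Complex.log (1 + -(z / q)), ?_, ?_⟩
  · apply ContinuousOn.add (hg.add continuousOn_const)
    exact ContinuousOn.clog (by fun_prop) hs
  · intro z hz
    rw [Complex.exp_add, Complex.exp_add, hge z hz,
      Complex.exp_log (Complex.slitPlane_ne_zero (hs z hz)), Complex.exp_log (neg_ne_zero.mpr hq0)]
    have h1 := hne z hz q hq
    field_simp
    ring

theorem const_of_exp_const {S : Set ℂ} (hS : IsPreconnected S) {h : ℂ → ℂ} {c : ℂ}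
    (hc : ContinuousOn h S) (he : ∀ z ∈ S, Complex.exp (h z) = c) :
    ∀ a ∈ S, ∀ b ∈ S, h a = h b := by
  intro a ha b hb
  have hcount : (Set.range fun n : ℤ => h a + n * (2 * Real.pi * Complex.I)).Countable :=
    Set.countable_range _
  have hsub : h '' S ⊆ Set.range fun n : ℤ => h a + n * (2 * Real.pi * Complex.I) := by
    rintro _ ⟨z, hz, rfl⟩
    obtain ⟨n, hn⟩ := Complex.exp_eq_exp_iff_exists_int.mp ((he z hz).trans (he a ha).symm)
    exact ⟨n, hn.symm⟩
  exact hcount.isTotallyDisconnected _ hsub (hS.image h hc)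
    (Set.mem_image_of_mem h ha) (Set.mem_image_of_mem h hb)

theorem sep_lemma_complex {K : Set ℂ} (hK : QProp K) {p : ℂ} (hp : p ∈ K)
    (htop : ∀ z ∈ K, z.re = p.re → z.im ≤ p.im) (hneg : ∀ z ∈ K, z.im ≤ 0)
    {A : Set ℂ} (hA : IsPreconnected A)
    (hAK : ∀ z ∈ A, z ∉ K ∧ ¬ (z.re = p.re ∧ p.im < z.im))
    {r l : ℂ} (hr : r ∈ A) (hl : l ∈ A) (hr2 : 0 < r.im) (hl2 : 0 < l.im)
    (hr1 : p.re < r.re) (hl1 : l.re < p.re) : False := by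
  set O : Set ℂ := {z | z ∉ K ∧ ¬ (z.re = p.re ∧ p.im ≤ z.im)} with hO
  have hOo : IsOpen O := by
    apply IsOpen.inter hK.1.isOpen_compl
    have : IsClosed {z : ℂ | z.re = p.re ∧ p.im ≤ z.im} :=
      (isClosed_eq Complex.continuous_re continuous_const).inter
        (isClosed_le continuous_const Complex.continuous_im)
    exact this.isOpen_compl
  have hAO : A ⊆ O := by
    intro z hz
    refine ⟨(hAK z hz).1, fun ⟨h1, h2⟩ => ?_⟩
    rcases h2.lt_or_eq with h2 | h2
    · exact (hAK z hz).2 ⟨h1, h2⟩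
    · have : z = p := Complex.ext h1 h2.symm
      exact (hAK z hz).1 (this ▸ hp)
  have hcc : IsPathConnected (connectedComponentIn O r) :=
    (hOo.connectedComponentIn.isConnected_iff_isPathConnected).mp
      (isConnected_connectedComponentIn_iff.mpr (hAO hr))
  have hlc : l ∈ connectedComponentIn O r := hA.subset_connectedComponentIn hr hAO hl
  obtain ⟨γ, hγ⟩ := hcc.joinedIn r (mem_connectedComponentIn (hAO hr)) l hlc
  have hγO : Set.range γ ⊆ O := by
    rintro _ ⟨t, rfl⟩
    exact connectedComponentIn_subset _ _ (hγ t)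
  have hseg : ∀ z ∈ segment ℝ r l, 0 < z.im := by
    have hcv : Convex ℝ {z : ℂ | 0 < z.im} := convex_halfSpace_im_gt 0
    intro z hz
    exact hcv.segment_subset hr2 hl2 hz
  have hsegc : IsCompact (segment ℝ r l) := by
    rw [segment_eq_image']
    exact isCompact_Icc.image (by fun_prop)
  have hsegp : IsPreconnected (segment ℝ r l) := (convex_segment r l).isPreconnected
  have hγp : IsPreconnected (Set.range γ) := isPreconnected_range γ.continuous
  obtain ⟨g, hg, hge⟩ := log_lemma hK hp (W := Set.range γ ∪ segment ℝ r l)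
    ((isCompact_range γ.continuous).union hsegc) (by
      rintro z (hz | hz)
      · exact (hγO hz).1
      · exact fun hzK => absurd (hneg z hzK) (not_le.mpr (hseg z hz)))
  have hs1 : ∀ z ∈ Set.range γ, (z - p) * Complex.I ∈ Complex.slitPlane := by
    intro z hz
    have := (hγO hz).2
    rw [Complex.mem_slitPlane_iff]
    simp only [Complex.mul_re, Complex.I_re, Complex.I_im, Complex.mul_im, Complex.sub_re,
      Complex.sub_im]
    by_cases h : z.re = p.re
    · left
      have : ¬ p.im ≤ z.im := fun h' => this ⟨h, h'⟩
      push Not at this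
      linarith
    · right
      intro h'
      apply h
      linarith
  have hpim := hneg p hp
  have hs2 : ∀ z ∈ segment ℝ r l, (z - p) * (-Complex.I) ∈ Complex.slitPlane := by
    intro z hz
    have := hseg z hz
    rw [Complex.mem_slitPlane_iff]
    left
    simp
    linarith
  have e1 := const_of_exp_const hγp (h := fun z => g z - Complex.log ((z - p) * Complex.I))
    (c := Complex.I⁻¹)
    ((hg.mono Set.subset_union_left).sub (ContinuousOn.clog (by fun_prop) hs1))
    (by
      intro z hz
      have h0 := Complex.slitPlane_ne_zero (hs1 z hz)
      rw [Complex.exp_sub, hge z (Or.inl hz), Complex.exp_log h0]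
      have : z - p ≠ 0 := left_ne_zero_of_mul h0
      field_simp) r ⟨0, γ.source⟩ l ⟨1, γ.target⟩
  have e2 := const_of_exp_const hsegp (h := fun z => g z - Complex.log ((z - p) * (-Complex.I)))
    (c := (-Complex.I)⁻¹)
    ((hg.mono Set.subset_union_right).sub (ContinuousOn.clog (by fun_prop) hs2))
    (by
      intro z hz
      have h0 := Complex.slitPlane_ne_zero (hs2 z hz)
      rw [Complex.exp_sub, hge z (Or.inr hz), Complex.exp_log h0]
      have : z - p ≠ 0 := left_ne_zero_of_mul h0
      field_simp) r (left_mem_segment ℝ r l) l (right_mem_segment ℝ r l)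
  have f1 : (Complex.arg ((r - p) * -Complex.I)) = Complex.arg ((r - p) * Complex.I) - Real.pi := by
    rw [mul_neg]
    apply Complex.arg_neg_eq_arg_sub_pi_of_im_pos
    simp; linarith
  have f2 : (Complex.arg ((l - p) * -Complex.I)) = Complex.arg ((l - p) * Complex.I) + Real.pi := by
    rw [mul_neg]
    apply Complex.arg_neg_eq_arg_add_pi_of_im_neg
    simp; linarith
  have e1' := congrArg Complex.im e1
  have e2' := congrArg Complex.im e2
  simp only [Complex.sub_im, Complex.log_im] at e1' e2'
  rw [f1, f2] at e2'
  linarith [Real.pi_pos]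

theorem sep_lemma {K : Set (ℝ × ℝ)} (hK : QProp K) {p : ℝ × ℝ} (hp : p ∈ K)
    (htop : ∀ z ∈ K, z.1 = p.1 → z.2 ≤ p.2) (hneg : ∀ z ∈ K, z.2 ≤ 0)
    {A : Set (ℝ × ℝ)} (hA : IsPreconnected A)
    (hAK : ∀ z ∈ A, z ∉ K ∧ ¬ (z.1 = p.1 ∧ p.2 < z.2))
    {r l : ℝ × ℝ} (hr : r ∈ A) (hl : l ∈ A) (hr2 : 0 < r.2) (hl2 : 0 < l.2)
    (hr1 : p.1 < r.1) (hl1 : l.1 < p.1) : False := by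
  let e : ℝ × ℝ ≃ₜ ℂ := Complex.equivRealProdCLM.symm.toHomeomorph
  have ere : ∀ z, (e z).re = z.1 := fun z => by simp [e]
  have eim : ∀ z, (e z).im = z.2 := fun z => by simp [e]
  apply sep_lemma_complex (hK.image e) (p := e p) (Set.mem_image_of_mem e hp)
    (A := e '' A) (r := e r) (l := e l) _ _ (hA.image e e.continuous.continuousOn) _
    (Set.mem_image_of_mem e hr) (Set.mem_image_of_mem e hl)
    (by rwa [eim]) (by rwa [eim]) (by rwa [ere, ere]) (by rwa [ere, ere])
  · rintro _ ⟨z, hz, rfl⟩ h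
    rw [ere, ere] at h
    rw [eim, eim]
    exact htop z hz h
  · rintro _ ⟨z, hz, rfl⟩
    rw [eim]; exact hneg z hz
  · rintro _ ⟨z, hz, rfl⟩
    rw [e.injective.mem_set_image, ere, ere, eim, eim]
    exact hAK z hz

namespace DehnLift

theorem horiz_int (L : DehnLift) (m : ℤ) (z : ℝ × ℝ) :
    L.F (z + ((m : ℝ), 0)) = L.F z + ((m : ℝ), 0) := by
  induction m with
  | zero => simp [Prod.mk_zero_zero]
  | succ i ih =>
    have h := L.horiz (z.1 + i) z.2
    have e1 : z + (((i : ℤ) : ℝ), (0 : ℝ)) = (z.1 + i, z.2) := by ext <;> simp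
    have e2 : z + ((((i : ℤ) + 1 : ℤ) : ℝ), (0 : ℝ)) = (z.1 + i + 1, z.2) := by
      ext <;> simp [add_assoc]
    rw [e2, h, ← e1, ih]
    ext <;> simp [add_assoc]
  | pred i ih =>
    have h := L.horiz (z.1 - i - 1) z.2
    have e1 : z + (((-(i : ℤ) : ℤ) : ℝ), (0 : ℝ)) = (z.1 - i - 1 + 1, z.2) := by
      ext <;> simp [sub_eq_add_neg]
    have e2 : z + (((-(i : ℤ) - 1 : ℤ) : ℝ), (0 : ℝ)) = (z.1 - i - 1, z.2) := by
      ext <;> simp; ring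
    rw [e1, h] at ih
    rw [e2]
    have ih' := eq_sub_of_add_eq ih
    rw [ih']
    ext <;> simp; ring

theorem vert_int (L : DehnLift) (j : ℤ) (z : ℝ × ℝ) :
    L.F (z + (0, (j : ℝ))) = L.F z + ((L.k : ℝ) * j, (j : ℝ)) := by
  induction j with
  | zero => simp [Prod.mk_zero_zero]
  | succ i ih =>
    have h := L.vert z.1 (z.2 + i)
    have e1 : z + ((0 : ℝ), ((i : ℤ) : ℝ)) = (z.1, z.2 + i) := by ext <;> simp
    have e2 : z + ((0 : ℝ), (((i : ℤ) + 1 : ℤ) : ℝ)) = (z.1, z.2 + i + 1) := by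
      ext <;> simp [add_assoc]
    rw [e2, h, ← e1, ih]
    ext <;> simp <;> ring
  | pred i ih =>
    have h := L.vert z.1 (z.2 - i - 1)
    have e1 : z + ((0 : ℝ), ((-(i : ℤ) : ℤ) : ℝ)) = (z.1, z.2 - i - 1 + 1) := by
      ext <;> simp [sub_eq_add_neg]
    have e2 : z + ((0 : ℝ), ((-(i : ℤ) - 1 : ℤ) : ℝ)) = (z.1, z.2 - i - 1) := by
      ext <;> simp; ring
    rw [e1, h] at ih
    rw [e2]
    have ih' := eq_sub_of_add_eq ih
    rw [ih']
    ext <;> simp <;> ring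

theorem transl (L : DehnLift) (a b : ℤ) (z : ℝ × ℝ) :
    L.F (z + ((a : ℝ), (b : ℝ))) = L.F z + (((a + L.k * b : ℤ) : ℝ), (b : ℝ)) := by
  have e : z + ((a : ℝ), (b : ℝ)) = (z + ((a : ℝ), 0)) + (0, (b : ℝ)) := by ext <;> simp
  rw [e, vert_int, horiz_int]
  ext <;> simp; ring

theorem iter_transl (L : DehnLift) (n : ℕ) : ∀ a b : ℤ, ∃ m : ℤ, ∀ z : ℝ × ℝ,
    (⇑L.F)^[n] (z + ((a : ℝ), (b : ℝ))) = (⇑L.F)^[n] z + ((m : ℝ), (b : ℝ)) := by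
  induction n with
  | zero => intro a b; exact ⟨a, fun z => rfl⟩
  | succ n ih =>
    intro a b
    obtain ⟨m, hm⟩ := ih (a + L.k * b) b
    refine ⟨m, fun z => ?_⟩
    rw [Function.iterate_succ_apply, Function.iterate_succ_apply, transl, hm]

theorem iter_horiz (L : DehnLift) (n : ℕ) (a : ℤ) (z : ℝ × ℝ) :
    (⇑L.F)^[n] (z + ((a : ℝ), 0)) = (⇑L.F)^[n] z + ((a : ℝ), 0) := by
  induction n generalizing z with
  | zero => rfl
  | succ n ih =>
    rw [Function.iterate_succ_apply, Function.iterate_succ_apply, horiz_int, ih]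

theorem iter_vert_snd (L : DehnLift) (n : ℕ) (b : ℤ) (z : ℝ × ℝ) :
    ((⇑L.F)^[n] (z + (0, (b : ℝ)))).2 = ((⇑L.F)^[n] z).2 + b := by
  obtain ⟨m, hm⟩ := L.iter_transl n 0 b
  have := hm z
  rw [Int.cast_zero] at this
  rw [this]; rfl

theorem exists_bound (L : DehnLift) : ∃ C : ℝ, 1 ≤ C ∧
    ∀ z : ℝ × ℝ, |(L.F z).1 - z.1 - L.k * z.2| ≤ C ∧ |(L.F z).2 - z.2| ≤ C := by
  have hcomp : IsCompact (Set.Icc (0 : ℝ) 1 ×ˢ Set.Icc (0 : ℝ) 1) := isCompact_Icc.prod isCompact_Icc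
  have hF := L.F.continuous
  obtain ⟨C1, h1⟩ := hcomp.exists_bound_of_continuousOn
    (f := fun z : ℝ × ℝ => (L.F z).1 - z.1 - L.k * z.2) (by fun_prop)
  obtain ⟨C2, h2⟩ := hcomp.exists_bound_of_continuousOn
    (f := fun z : ℝ × ℝ => (L.F z).2 - z.2) (by fun_prop)
  refine ⟨max 1 (max C1 C2), le_max_left _ _, fun z => ?_⟩
  set w : ℝ × ℝ := (Int.fract z.1, Int.fract z.2) with hw
  have hz : z = w + ((⌊z.1⌋ : ℝ), (⌊z.2⌋ : ℝ)) := by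
    ext <;> simp [hw]
  have hwm : w ∈ Set.Icc (0 : ℝ) 1 ×ˢ Set.Icc (0 : ℝ) 1 :=
    ⟨⟨Int.fract_nonneg _, (Int.fract_lt_one _).le⟩, ⟨Int.fract_nonneg _, (Int.fract_lt_one _).le⟩⟩
  have b1 := h1 w hwm
  have b2 := h2 w hwm
  rw [Real.norm_eq_abs] at b1 b2
  have hFz : L.F z = L.F w + (((⌊z.1⌋ + L.k * ⌊z.2⌋ : ℤ) : ℝ), (⌊z.2⌋ : ℝ)) := by
    conv_lhs => rw [hz]
    exact L.transl _ _ _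
  have z1 : z.1 = w.1 + ⌊z.1⌋ := by simp [hw]
  have z2 : z.2 = w.2 + ⌊z.2⌋ := by simp [hw]
  constructor
  · have : (L.F z).1 - z.1 - L.k * z.2 = (L.F w).1 - w.1 - L.k * w.2 := by
      rw [hFz]
      simp only [Prod.fst_add]
      push_cast
      linear_combination (-1 : ℝ) * z1 - (L.k : ℝ) * z2
    rw [this]
    exact b1.trans ((le_max_left _ _).trans (le_max_right _ _))
  · have : (L.F z).2 - z.2 = (L.F w).2 - w.2 := by
      rw [hFz]
      simp only [Prod.snd_add]
      linear_combination (-1 : ℝ) * z2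
    rw [this]
    exact b2.trans ((le_max_right _ _).trans (le_max_right _ _))

theorem iter_bound (L : DehnLift) {C : ℝ} (hC : ∀ z : ℝ × ℝ, |(L.F z).2 - z.2| ≤ C)
    (n : ℕ) (z : ℝ × ℝ) : |((⇑L.F)^[n] z).2 - z.2| ≤ C * n := by
  induction n with
  | zero => simp [Prod.mk_zero_zero]
  | succ n ih =>
    rw [Function.iterate_succ_apply']
    have := hC ((⇑L.F)^[n] z)
    rw [abs_le] at *
    push_cast
    constructor <;> linarith [ih.1, ih.2, this.1, this.2]

/-- The uniform zero vertical rotation property. -/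
def RotZ (L : DehnLift) : Prop :=
  ∀ ε > (0 : ℝ), ∃ N : ℕ, ∀ n ≥ N, ∀ z : ℝ × ℝ, |((⇑L.F)^[n] z).2 - z.2| ≤ ε * n

theorem rotZ_of_rotSet (L : DehnLift) (fhat : Cyl → Cyl)
    (hfhat : ∀ z : ℝ × ℝ, projCyl (L.F z) = fhat (projCyl z))
    (hrot : rotSet fhat = {(0:ℝ)}) : L.RotZ := by
  obtain ⟨C, hC1, hC⟩ := L.exists_bound
  have hit : ∀ (n : ℕ) (z : ℝ × ℝ), projCyl ((⇑L.F)^[n] z) = fhat^[n] (projCyl z) := by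
    intro n z
    induction n with
    | zero => rfl
    | succ n ih => rw [Function.iterate_succ_apply', Function.iterate_succ_apply', hfhat, ih]
  intro ε hε
  by_contra hcon
  push Not at hcon
  have hne : ∀ i : ℕ, ((closure (⋃ n : ℕ, ⋃ _ : i + 1 ≤ n,
    {r : ℝ | ∃ z : Cyl, r = ((fhat^[n] z).2 - z.2) / n})) ∩
      (Set.Icc (-C) C ∩ {r : ℝ | ε ≤ |r|})).Nonempty := by
    intro i
    obtain ⟨n, hn, z, hz⟩ := hcon (i + 1)
    have hn0 : (0 : ℝ) < n := by exact_mod_cast (by omega : 0 < n)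
    refine ⟨(((⇑L.F)^[n] z).2 - z.2) / n, ?_, ?_, ?_⟩
    · apply subset_closure
      refine Set.mem_iUnion₂.mpr ⟨n, hn, projCyl z, ?_⟩
      rw [← hit]; rfl
    · have := L.iter_bound (fun z => (hC z).2) n z
      rw [Set.mem_Icc, ← abs_le, abs_div, abs_of_pos hn0, div_le_iff₀ hn0]
      exact this
    · change ε ≤ |_|
      rw [abs_div, abs_of_pos hn0, le_div_iff₀ hn0]
      exact hz.le
  have hcl : IsClosed (Set.Icc (-C) C ∩ {r : ℝ | ε ≤ |r|}) :=
    isClosed_Icc.inter (isClosed_le continuous_const continuous_abs)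
  have hcp : IsCompact (Set.Icc (-C) C ∩ {r : ℝ | ε ≤ |r|}) :=
    isCompact_Icc.inter_right (isClosed_le continuous_const continuous_abs)
  obtain ⟨r, hr⟩ := IsCompact.nonempty_iInter_of_sequence_nonempty_isCompact_isClosed _
    (by
      intro i
      apply Set.inter_subset_inter_left
      apply closure_mono
      intro r hr
      obtain ⟨n, hn, h⟩ := Set.mem_iUnion₂.mp hr
      exact Set.mem_iUnion₂.mpr ⟨n, by omega, h⟩) hne
    (hcp.inter_left isClosed_closure) (fun i => isClosed_closure.inter hcl)
  rw [Set.mem_iInter] at hr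
  have : r ∈ rotSet fhat := Set.mem_iInter.mpr fun i => (hr i).1
  rw [hrot] at this
  have h2 := (hr 0).2.2
  rw [Set.mem_singleton_iff] at this
  rw [this] at h2
  simp at h2
  linarith

/-- Points whose first `n` iterates stay in the closed lower half plane. -/
def Hn (L : DehnLift) (n : ℕ) : Set (ℝ × ℝ) := {z | ∀ i ≤ n, ((⇑L.F)^[i] z).2 ≤ 0}

/-- The lower component of `Hn`. -/
def En (L : DehnLift) (C : ℝ) (n : ℕ) : Set (ℝ × ℝ) := connectedComponentIn (L.Hn n) (0, -C * n)

theorem continuous_iter (L : DehnLift) (n : ℕ) : Continuous ((⇑L.F)^[n]) :=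
  L.F.continuous.iterate n

theorem Hn_closed (L : DehnLift) (n : ℕ) : IsClosed (L.Hn n) := by
  have : L.Hn n = ⋂ i : ℕ, ⋂ _ : i ≤ n, {z | ((⇑L.F)^[i] z).2 ≤ 0} := by
    ext z; simp [Hn]
  rw [this]
  exact isClosed_iInter fun i => isClosed_iInter fun _ =>
    isClosed_le (continuous_snd.comp (L.continuous_iter i)) continuous_const

theorem low_subset_Hn (L : DehnLift) {C : ℝ} (hC1 : 1 ≤ C)
    (hC : ∀ z : ℝ × ℝ, |(L.F z).2 - z.2| ≤ C) (n : ℕ) :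
    {z : ℝ × ℝ | z.2 ≤ -C * n} ⊆ L.Hn n := by
  intro z hz i hi
  have h := (abs_le.mp (L.iter_bound hC i z)).2
  have : C * i ≤ C * n := by gcongr
  have hz' : z.2 ≤ -C * n := hz
  linarith

theorem low_preconnected (c : ℝ) : IsPreconnected {z : ℝ × ℝ | z.2 ≤ c} :=
  (convex_halfSpace_le (f := fun z : ℝ × ℝ => z.2) ⟨fun _ _ => rfl, fun _ _ => rfl⟩ c).isPreconnected

theorem En_max (L : DehnLift) {C : ℝ} (hC1 : 1 ≤ C)
    (hC : ∀ z : ℝ × ℝ, |(L.F z).2 - z.2| ≤ C) {n : ℕ} {A : Set (ℝ × ℝ)} (hA : IsPreconnected A)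
    (hAH : A ⊆ L.Hn n) {x : ℝ × ℝ} (hx : x ∈ A) (hx2 : x.2 ≤ -C * n) : A ⊆ L.En C n := by
  have h := IsPreconnected.union x hx (show x ∈ {z : ℝ × ℝ | z.2 ≤ -C * n} from hx2) hA
    (low_preconnected _)
  exact Set.subset_union_left.trans (h.subset_connectedComponentIn
    (Or.inr (show ((0 : ℝ), -C * n).2 ≤ -C * n from le_rfl))
    (Set.union_subset hAH (L.low_subset_Hn hC1 hC n)))

theorem low_subset_En (L : DehnLift) {C : ℝ} (hC1 : 1 ≤ C)
    (hC : ∀ z : ℝ × ℝ, |(L.F z).2 - z.2| ≤ C) (n : ℕ) :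
    {z : ℝ × ℝ | z.2 ≤ -C * n} ⊆ L.En C n :=
  L.En_max hC1 hC (low_preconnected _) (L.low_subset_Hn hC1 hC n)
    (show ((0 : ℝ), -C * n) ∈ _ from (le_rfl : -C * (n : ℝ) ≤ -C * n)) le_rfl

theorem En_subset (L : DehnLift) (C : ℝ) (n : ℕ) : L.En C n ⊆ L.Hn n :=
  connectedComponentIn_subset _ _

theorem En_preconnected (L : DehnLift) (C : ℝ) (n : ℕ) : IsPreconnected (L.En C n) :=
  isPreconnected_connectedComponentIn

theorem En_closed (L : DehnLift) {C : ℝ} (hC1 : 1 ≤ C)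
    (hC : ∀ z : ℝ × ℝ, |(L.F z).2 - z.2| ≤ C) (n : ℕ) : IsClosed (L.En C n) := by
  apply isClosed_of_closure_subset
  apply L.En_max hC1 hC (L.En_preconnected C n).closure
    ((L.Hn_closed n).closure_subset_iff.mpr (L.En_subset C n))
    (subset_closure (L.low_subset_En hC1 hC n (show ((0 : ℝ), -C * n).2 ≤ -C * n from le_rfl)))
  exact le_rfl

theorem En_transl (L : DehnLift) {C : ℝ} (hC1 : 1 ≤ C)
    (hC : ∀ z : ℝ × ℝ, |(L.F z).2 - z.2| ≤ C) (n : ℕ) (a : ℤ) {z : ℝ × ℝ} (hz : z ∈ L.En C n) :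
    z + ((a : ℝ), 0) ∈ L.En C n := by
  have hs : (fun w : ℝ × ℝ => w + ((a : ℝ), (0 : ℝ))) '' L.En C n ⊆ L.En C n := by
    apply L.En_max hC1 hC ((L.En_preconnected C n).image _ (by fun_prop)) _
      (Set.mem_image_of_mem _
        (L.low_subset_En hC1 hC n (show ((0 : ℝ), -C * n).2 ≤ -C * n from le_rfl)))
    · simp
    · rintro _ ⟨w, hw, rfl⟩ i hi
      have := L.En_subset C n hw i hi
      simp only [iter_horiz, Prod.snd_add, add_zero]
      exact this
  exact hs (Set.mem_image_of_mem _ hz)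

theorem En_anti (L : DehnLift) {C : ℝ} (hC1 : 1 ≤ C)
    (hC : ∀ z : ℝ × ℝ, |(L.F z).2 - z.2| ≤ C) : Antitone (L.En C) := by
  intro m n hmn
  apply L.En_max hC1 hC (L.En_preconnected C n) (fun z hz i hi => L.En_subset C n hz i (hi.trans hmn))
    (L.low_subset_En hC1 hC n (show ((0 : ℝ), -C * n).2 ≤ -C * n from le_rfl))
  have : C * (m : ℝ) ≤ C * n := by gcongr
  change -C * (n : ℝ) ≤ _
  linarith

theorem En_map (L : DehnLift) {C : ℝ} (hC1 : 1 ≤ C)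
    (hC : ∀ z : ℝ × ℝ, |(L.F z).2 - z.2| ≤ C) (n i : ℕ) {z : ℝ × ℝ} (hz : z ∈ L.En C (n + i)) :
    (⇑L.F)^[i] z ∈ L.En C n := by
  have hs : (⇑L.F)^[i] '' L.En C (n + i) ⊆ L.En C n := by
    apply L.En_max hC1 hC ((L.En_preconnected C _).image _ (L.continuous_iter i).continuousOn) _
      (Set.mem_image_of_mem _
        (L.low_subset_En hC1 hC (n + i) (show ((0 : ℝ), -C * (n + i : ℕ)).2 ≤ _ from le_rfl)))
    · have := (abs_le.mp (L.iter_bound hC i ((0 : ℝ), -C * (n + i : ℕ)))).2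
      push_cast at this ⊢

      linarith
    · rintro _ ⟨w, hw, rfl⟩ j hj
      rw [← Function.iterate_add_apply]
      exact L.En_subset C _ hw (j + i) (by omega)
  exact hs (Set.mem_image_of_mem _ hz)

theorem En_touch (L : DehnLift) {C : ℝ} (hC1 : 1 ≤ C)
    (hC : ∀ z : ℝ × ℝ, |(L.F z).2 - z.2| ≤ C) (n : ℕ) :
    ∃ z ∈ L.En C n, ∃ i ≤ n, 0 ≤ ((⇑L.F)^[i] z).2 := by
  by_contra hcon
  push Not at hcon
  have hop : IsOpen (L.En C n) := by
    rw [isOpen_iff_mem_nhds]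
    intro z hz
    have hU : IsOpen {w : ℝ × ℝ | ∀ i ≤ n, ((⇑L.F)^[i] w).2 < 0} := by
      have : {w : ℝ × ℝ | ∀ i ≤ n, ((⇑L.F)^[i] w).2 < 0} =
          ⋂ i ∈ Finset.range (n + 1), {w | ((⇑L.F)^[i] w).2 < 0} := by
        ext w; simp
      rw [this]
      exact isOpen_biInter_finset fun i _ =>
        isOpen_lt (continuous_snd.comp (L.continuous_iter i)) continuous_const
    obtain ⟨ε, hε, hb⟩ := Metric.isOpen_iff.mp hU z (hcon z hz)
    have hbs : Metric.ball z ε ⊆ L.En C n := by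
      have h1 : L.En C n = connectedComponentIn (L.Hn n) z := connectedComponentIn_eq hz
      rw [h1]
      exact (convex_ball z ε).isPreconnected.subset_connectedComponentIn
        (Metric.mem_ball_self hε) (fun w hw i hi => (hb hw i hi).le)
    exact Filter.mem_of_superset (Metric.ball_mem_nhds z hε) hbs
  have hcl : IsClopen (L.En C n) := ⟨L.En_closed hC1 hC n, hop⟩
  rcases isClopen_iff.mp hcl with h | h
  · have := L.low_subset_En hC1 hC n (show ((0 : ℝ), -C * n).2 ≤ -C * n from le_rfl)
    rw [h] at this; exact this
  · have h1 : ((0 : ℝ), (1 : ℝ)) ∈ L.En C n := by rw [h]; trivial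
    have := L.En_subset C n h1 0 (Nat.zero_le _)
    simp at this
    linarith

theorem En_high (L : DehnLift) (hrot : L.RotZ) {C : ℝ} (hC1 : 1 ≤ C)
    (hC : ∀ z : ℝ × ℝ, |(L.F z).2 - z.2| ≤ C) (n : ℕ) (hn : 1 ≤ n) :
    ∃ z ∈ L.En C n, -1 < z.2 := by
  by_contra hcon
  push Not at hcon
  have hnR : (1 : ℝ) ≤ n := by exact_mod_cast hn
  have key : ∀ p : ℕ, ∀ z ∈ L.En C (p * n), z.2 ≤ -p := by
    intro p
    induction p with
    | zero =>
      intro z hz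
      have := L.En_subset C _ hz 0 (Nat.zero_le _)
      simpa using this
    | succ p ih =>
      have hs : (fun w : ℝ × ℝ => w + ((0 : ℝ), ((p : ℤ) : ℝ))) '' L.En C ((p + 1) * n) ⊆
          L.En C n := by
        apply L.En_max hC1 hC ((L.En_preconnected C _).image _ (by fun_prop)) _
          (Set.mem_image_of_mem _
            (L.low_subset_En hC1 hC ((p + 1) * n)
              (show ((0 : ℝ), -C * ((p + 1) * n : ℕ)).2 ≤ _ from le_rfl)))
        · push_cast
          simp only [Prod.snd_add]
          have h1 : (p : ℝ) * 1 ≤ p * (C * n) := by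
            gcongr
            nlinarith
          nlinarith
        · rintro _ ⟨w, hw, rfl⟩ i hi
          have h1 : (⇑L.F)^[i] w ∈ L.En C (p * n) := by
            apply L.En_map hC1 hC
            apply L.En_anti hC1 hC _ hw
            rw [add_mul, one_mul]; omega
          have h2 := ih _ h1
          have h3 := L.iter_vert_snd i p w
          simp only [h3]
          push_cast
          linarith
      intro z hz
      have := hcon _ (hs (Set.mem_image_of_mem _ hz))
      simp only [Prod.snd_add] at this
      push_cast at this ⊢
      linarith
  obtain ⟨N, hN⟩ := hrot (1 / (2 * n)) (by positivity)
  obtain ⟨p, hp⟩ := exists_nat_gt (C * N)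
  obtain ⟨z, hz, i, hi, hiz⟩ := L.En_touch hC1 hC (p * n)
  have h1 := key p z hz
  have h2 := (abs_le.mp (L.iter_bound hC i z)).2
  have hp0 : (0 : ℝ) < p := lt_of_le_of_lt (by positivity) hp
  have hiN : N ≤ i := by
    have : C * (N : ℝ) < C * i := by linarith
    have := lt_of_mul_lt_mul_left this (by linarith)
    exact_mod_cast this.le
  have h3 := (abs_le.mp (hN i hiN z)).2
  have h4 : 1 / (2 * (n : ℝ)) * i ≤ 1 / (2 * n) * (p * n) := by
    gcongr
    exact_mod_cast hi
  have h5 : 1 / (2 * (n : ℝ)) * (p * n) = p / 2 := by field_simp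
  linarith

/-- The compact box used for limit arguments. -/
def box : Set (ℝ × ℝ) := Set.Icc (0 : ℝ) 1 ×ˢ Set.Icc (-1 : ℝ) 0

theorem box_compact : IsCompact box := isCompact_Icc.prod isCompact_Icc

theorem meets_box {A : Set (ℝ × ℝ)} (hA : ∀ z ∈ A, ∀ a : ℤ, z + ((a : ℝ), (0 : ℝ)) ∈ A)
    {z : ℝ × ℝ} (hz : z ∈ A) (h1 : -1 ≤ z.2) (h2 : z.2 ≤ 0) : (A ∩ box).Nonempty := by
  refine ⟨z + (((-⌊z.1⌋ : ℤ) : ℝ), 0), hA z hz _, ⟨?_, ?_⟩, ?_, ?_⟩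
  · simp [Int.floor_le]
  · simp only [Prod.fst_add]; push_cast; linarith [Int.lt_floor_add_one z.1]
  · simpa using h1
  · simpa using h2

/-- The intersection of the lower components. -/
def EE (L : DehnLift) (C : ℝ) : Set (ℝ × ℝ) := ⋂ n, L.En C n

theorem image_iter_closed (L : DehnLift) (n : ℕ) {A : Set (ℝ × ℝ)} (hA : IsClosed A) :
    IsClosed ((⇑L.F)^[n] '' A) := by
  induction n with
  | zero => simpa using hA
  | succ n ih =>
    rw [Function.iterate_succ', Set.image_comp]
    exact L.F.isClosedMap _ ih

theorem image_iter_QProp (L : DehnLift) (n : ℕ) {A : Set (ℝ × ℝ)} (hA : QProp A) :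
    QProp ((⇑L.F)^[n] '' A) := by
  induction n with
  | zero => simpa using hA
  | succ n ih =>
    rw [Function.iterate_succ', Set.image_comp]
    exact ih.image L.F

theorem En_QProp (L : DehnLift) {C : ℝ} (hC1 : 1 ≤ C)
    (hC : ∀ z : ℝ × ℝ, |(L.F z).2 - z.2| ≤ C) (n : ℕ) : QProp (L.En C n) := by
  apply QProp.of_connected (L.En_closed hC1 hC n) (L.En_preconnected C n)
  intro hcomp
  obtain ⟨R, hR⟩ := hcomp.isBounded.subset_closedBall 0
  have hm : ((0 : ℝ), min (-C * n) (-(R + 1))) ∈ L.En C n :=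
    L.low_subset_En hC1 hC n (show min (-C * n) (-(R + 1)) ≤ -C * (n : ℝ) from min_le_left _ _)
  have := mem_closedBall_zero_iff.mp (hR hm)
  have h2 := (norm_snd_le _).trans this
  rw [Real.norm_eq_abs] at h2
  have h3 := (abs_le.mp h2).1
  have h4 : min (-C * (n : ℝ)) (-(R + 1)) ≤ -(R + 1) := min_le_right _ _
  dsimp only at h3
  linarith

theorem EE_map (L : DehnLift) {C : ℝ} (hC1 : 1 ≤ C)
    (hC : ∀ z : ℝ × ℝ, |(L.F z).2 - z.2| ≤ C) (i : ℕ) {z : ℝ × ℝ} (hz : z ∈ L.EE C) :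
    (⇑L.F)^[i] z ∈ L.EE C :=
  Set.mem_iInter.mpr fun n => L.En_map hC1 hC n i (Set.mem_iInter.mp hz (n + i))

theorem EE_transl (L : DehnLift) {C : ℝ} (hC1 : 1 ≤ C)
    (hC : ∀ z : ℝ × ℝ, |(L.F z).2 - z.2| ≤ C) (a : ℤ) {z : ℝ × ℝ} (hz : z ∈ L.EE C) :
    z + ((a : ℝ), 0) ∈ L.EE C :=
  Set.mem_iInter.mpr fun n => L.En_transl hC1 hC n a (Set.mem_iInter.mp hz n)

theorem EE_nonpos (L : DehnLift) (C : ℝ) {z : ℝ × ℝ} (hz : z ∈ L.EE C) : z.2 ≤ 0 :=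
  L.En_subset C 0 (Set.mem_iInter.mp hz 0) 0 le_rfl

theorem EE_box (L : DehnLift) (hrot : L.RotZ) {C : ℝ} (hC1 : 1 ≤ C)
    (hC : ∀ z : ℝ × ℝ, |(L.F z).2 - z.2| ≤ C) : (L.EE C ∩ box).Nonempty := by
  have hne : ∀ n, (L.En C n ∩ box).Nonempty := by
    intro n
    obtain ⟨z, hz, h⟩ := L.En_high hrot hC1 hC (n + 1) (by omega)
    have hz' := L.En_anti hC1 hC (Nat.le_succ n) hz
    exact meets_box (fun z hz a => L.En_transl hC1 hC n a hz) hz' h.le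
      (L.En_subset C n hz' 0 (Nat.zero_le _))
  obtain ⟨z, hz⟩ := IsCompact.nonempty_iInter_of_sequence_nonempty_isCompact_isClosed
    (fun n => L.En C n ∩ box)
    (fun n => Set.inter_subset_inter_left _ (L.En_anti hC1 hC (Nat.le_succ n))) hne
    (box_compact.inter_left (L.En_closed hC1 hC 0))
    (fun n => (L.En_closed hC1 hC n).inter box_compact.isClosed)
  rw [Set.mem_iInter] at hz
  exact ⟨z, Set.mem_iInter.mpr fun n => (hz n).1, (hz 0).2⟩

theorem iterEE_box (L : DehnLift) (hrot : L.RotZ) {C : ℝ} (hC1 : 1 ≤ C)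
    (hC : ∀ z : ℝ × ℝ, |(L.F z).2 - z.2| ≤ C) (n : ℕ) :
    ((⇑L.F)^[n] '' L.EE C ∩ box).Nonempty := by
  rcases Nat.eq_zero_or_pos n with rfl | hn
  · simpa using L.EE_box hrot hC1 hC
  by_contra hcon
  have hex : ∃ l, ¬ ((⇑L.F)^[n] '' L.En C l ∩ box).Nonempty := by
    by_contra hall
    push Not at hall
    obtain ⟨w, hw⟩ := IsCompact.nonempty_iInter_of_sequence_nonempty_isCompact_isClosed
      (fun l => (⇑L.F)^[n] '' L.En C l ∩ box)
      (fun l => Set.inter_subset_inter_left _ (Set.image_mono (L.En_anti hC1 hC (Nat.le_succ l))))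
      hall
      (box_compact.inter_left (L.image_iter_closed n (L.En_closed hC1 hC 0)))
      (fun l => (L.image_iter_closed n (L.En_closed hC1 hC l)).inter box_compact.isClosed)
    rw [Set.mem_iInter] at hw
    apply hcon
    refine ⟨w, ?_, (hw 0).2⟩
    obtain ⟨z, _, hzw⟩ := (hw 0).1
    refine ⟨z, Set.mem_iInter.mpr fun l => ?_, hzw⟩
    obtain ⟨z', hz', hzw'⟩ := (hw l).1
    have : z' = z := (L.F.injective.iterate n) (hzw'.trans hzw.symm)
    rwa [← this]
  obtain ⟨l0, hl0⟩ := hex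
  set l := l0 + n with hl
  have hlow : ∀ z ∈ L.En C l, ((⇑L.F)^[n] z).2 < -1 := by
    intro z hz
    by_contra hge
    push Not at hge
    apply hl0
    apply meets_box (z := (⇑L.F)^[n] z) _ _ hge (L.En_subset C l hz n (by omega))
    · rintro _ ⟨w, hw, rfl⟩ a
      exact ⟨w + ((a : ℝ), 0), L.En_transl hC1 hC l0 a hw, L.iter_horiz n a w⟩
    · exact ⟨z, L.En_anti hC1 hC (by omega) hz, rfl⟩
  have hshift : ∀ m, ∀ z ∈ L.En C (l + m), (⇑L.F)^[n] z + ((0 : ℝ), ((1 : ℤ) : ℝ)) ∈ L.En C m := by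
    intro m
    have hs : (fun z => (⇑L.F)^[n] z + ((0 : ℝ), ((1 : ℤ) : ℝ))) '' L.En C (l + m) ⊆ L.En C m := by
      have hlm : ((0 : ℝ), -C * (l + m : ℕ) - C * n - 1) ∈ L.En C (l + m) := by
        apply L.low_subset_En hC1 hC
        change -C * ((l + m : ℕ) : ℝ) - C * n - 1 ≤ -C * (l + m : ℕ)
        have : 0 ≤ C * (n : ℝ) := by positivity
        linarith
      have hct : Continuous fun z => (⇑L.F)^[n] z + ((0 : ℝ), ((1 : ℤ) : ℝ)) :=
        (L.continuous_iter n).add continuous_const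
      apply L.En_max hC1 hC ((L.En_preconnected C _).image _ hct.continuousOn) _
        (Set.mem_image_of_mem _ hlm)
      · have h1 := (abs_le.mp (L.iter_bound hC n ((0 : ℝ), -C * (l + m : ℕ) - C * n - 1))).2
        have h2 : 0 ≤ C * (l : ℝ) := by positivity
        simp only [Prod.snd_add]
        push_cast at h1 ⊢
        linarith
      · rintro _ ⟨w, hw, rfl⟩ i hi
        have h1 : (⇑L.F)^[i] w ∈ L.En C l := by
          apply L.En_map hC1 hC
          exact L.En_anti hC1 hC (by omega) hw
        have h2 := hlow _ h1
        rw [← Function.iterate_add_apply, add_comm, Function.iterate_add_apply] at h2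
        have h3 := L.iter_vert_snd i 1 ((⇑L.F)^[n] w)
        simp only [h3]
        push_cast
        linarith
    intro z hz
    exact hs (Set.mem_image_of_mem _ hz)
  have hEE : ∀ z ∈ L.EE C, (⇑L.F)^[n] z + ((0 : ℝ), ((1 : ℤ) : ℝ)) ∈ L.EE C := fun z hz =>
    Set.mem_iInter.mpr fun m => hshift m z (Set.mem_iInter.mp hz (l + m))
  have hdrop : ∀ p : ℕ, ∀ z ∈ L.EE C, ((⇑L.F)^[n * p] z).2 ≤ -p := by
    intro p
    induction p with
    | zero => intro z hz; simpa using L.EE_nonpos C hz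
    | succ p ih =>
      intro z hz
      have h1 := ih _ (hEE z hz)
      rw [L.iter_vert_snd, ← Function.iterate_add_apply] at h1
      rw [Nat.mul_succ]
      push_cast at h1 ⊢
      linarith
  obtain ⟨z, hz, hzb⟩ := L.EE_box hrot hC1 hC
  have hnR : (1 : ℝ) ≤ n := by exact_mod_cast hn
  obtain ⟨N, hN⟩ := hrot (1 / (2 * n)) (by positivity)
  have h1 := hdrop (N + 3) z hz
  have h2 := (abs_le.mp (hN (n * (N + 3)) (by nlinarith) z)).1
  have h5 : 1 / (2 * (n : ℝ)) * (n * (N + 3) : ℕ) = (N + 3) / 2 := by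
    push_cast; field_simp
  rw [h5] at h2
  have h6 : -1 ≤ z.2 := hzb.2.1
  push_cast at h1
  have : (0 : ℝ) ≤ N := by positivity
  linarith

theorem exists_K (L : DehnLift) (hrot : L.RotZ) : ∃ K : Set (ℝ × ℝ), QProp K ∧
    (∀ z, L.F z ∈ K ↔ z ∈ K) ∧ (∀ z ∈ K, ∀ m : ℤ, z + ((m : ℝ), (0 : ℝ)) ∈ K) ∧
    (∀ z ∈ K, z.2 ≤ 0) ∧ ∃ z ∈ K, -1 ≤ z.2 := by
  obtain ⟨C, hC1, hC'⟩ := L.exists_bound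
  have hC : ∀ z : ℝ × ℝ, |(L.F z).2 - z.2| ≤ C := fun z => (hC' z).2
  have hQE : QProp (L.EE C) := QProp.iInter (L.En_anti hC1 hC) (L.En_QProp hC1 hC)
  have hanti : Antitone fun n => (⇑L.F)^[n] '' L.EE C := by
    apply antitone_nat_of_succ_le
    rintro n _ ⟨z, hz, rfl⟩
    exact ⟨L.F z, L.EE_map hC1 hC 1 hz, rfl⟩
  refine ⟨⋂ n, (⇑L.F)^[n] '' L.EE C, QProp.iInter hanti fun n => L.image_iter_QProp n hQE,
    ?_, ?_, ?_, ?_⟩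
  · intro z
    rw [Set.mem_iInter, Set.mem_iInter]
    constructor
    · intro h n
      obtain ⟨w, hw, hwz⟩ := h (n + 1)
      rw [Function.iterate_succ_apply'] at hwz
      exact ⟨w, hw, L.F.injective hwz⟩
    · intro h n
      obtain ⟨w, hw, rfl⟩ := h n
      refine ⟨L.F w, L.EE_map hC1 hC 1 hw, ?_⟩
      rw [← Function.iterate_succ_apply, Function.iterate_succ_apply']
  · intro z hz m
    rw [Set.mem_iInter] at hz ⊢
    intro n
    obtain ⟨w, hw, rfl⟩ := hz n
    exact ⟨w + ((m : ℝ), 0), L.EE_transl hC1 hC m hw, L.iter_horiz n m w⟩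
  · intro z hz
    obtain ⟨w, hw, hwz⟩ := Set.mem_iInter.mp hz 0
    rw [← hwz]
    exact L.EE_nonpos C hw
  · obtain ⟨z, hz⟩ := IsCompact.nonempty_iInter_of_sequence_nonempty_isCompact_isClosed
      (fun n => (⇑L.F)^[n] '' L.EE C ∩ box)
      (fun n => Set.inter_subset_inter_left _ (hanti (Nat.le_succ n)))
      (fun n => L.iterEE_box hrot hC1 hC n)
      (box_compact.inter_left (L.image_iter_closed 0 hQE.1))
      (fun n => (L.image_iter_closed n hQE.1).inter box_compact.isClosed)
    rw [Set.mem_iInter] at hz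
    exact ⟨z, Set.mem_iInter.mpr fun n => (hz n).1, (hz 0).2.2.1⟩

theorem upper (L : DehnLift) (hrot : L.RotZ) : ∃ M0 > (0 : ℝ), ∀ (x : ℝ) (n : ℕ), 0 < n →
    ∀ y ≥ M0, ((⇑L.F)^[n] (x, y)).1 = x → ((⇑L.F)^[n] (x, y)).2 < M0 := by
  obtain ⟨K, hQ, hKF, hKT, hKn, z0, hz0, hz01⟩ := L.exists_K hrot
  obtain ⟨C, hC1, hC⟩ := L.exists_bound
  have hk1 : (1 : ℝ) ≤ L.k := by exact_mod_cast L.k_pos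
  set a := z0.1 with ha
  obtain ⟨p, hpK, hpa, hp1, hptop⟩ : ∃ p ∈ K, p.1 = a ∧ -1 ≤ p.2 ∧ ∀ z ∈ K, z.1 = a → z.2 ≤ p.2 := by
    have hcp : IsCompact (K ∩ (({a} : Set ℝ) ×ˢ Set.Icc (-1 : ℝ) 0)) :=
      (isCompact_singleton.prod isCompact_Icc).inter_left hQ.1
    obtain ⟨p, hp, hmax⟩ := hcp.exists_isMaxOn ⟨z0, hz0, rfl, hz01, hKn z0 hz0⟩
      (f := fun z : ℝ × ℝ => z.2) continuous_snd.continuousOn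
    refine ⟨p, hp.1, hp.2.1, hp.2.2.1, fun z hz hza => ?_⟩
    by_cases h : -1 ≤ z.2
    · exact hmax ⟨hz, hza, h, hKn z hz⟩
    · push Not at h
      exact h.le.trans hp.2.2.1
  have hp0 : p.2 ≤ 0 := hKn p hpK
  have htop : ∀ i : ℤ, ∀ z ∈ K, z.1 = a + i → z.2 ≤ p.2 := by
    intro i z hz hzi
    have := hptop _ (hKT z hz (-i)) (by simp [hzi])
    simpa using this
  set O : ℤ → Set (ℝ × ℝ) := fun i => {z | z ∉ K ∧ ¬ (z.1 = a + i ∧ p.2 < z.2)} with hO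
  set R : ℤ → Set (ℝ × ℝ) := fun i => connectedComponentIn (O i) (a + i + 1, 1) with hR
  have hquO : ∀ i : ℤ, {z : ℝ × ℝ | a + i < z.1 ∧ 0 < z.2} ⊆ O i := by
    rintro i z ⟨h1, h2⟩
    exact ⟨fun hz => absurd (hKn z hz) (not_le.mpr h2), fun h => h1.ne' h.1⟩
  have hqup : ∀ i : ℤ, IsPreconnected {z : ℝ × ℝ | a + i < z.1 ∧ 0 < z.2} := by
    intro i
    have h1 : Convex ℝ {z : ℝ × ℝ | a + i < z.1} :=
      convex_halfSpace_gt (f := fun z : ℝ × ℝ => z.1) ⟨fun _ _ => rfl, fun _ _ => rfl⟩ _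
    have h2 : Convex ℝ {z : ℝ × ℝ | 0 < z.2} :=
      convex_halfSpace_gt (f := fun z : ℝ × ℝ => z.2) ⟨fun _ _ => rfl, fun _ _ => rfl⟩ _
    exact (h1.inter h2).isPreconnected
  have hbase : ∀ i : ℤ, ((a + i + 1, 1) : ℝ × ℝ) ∈ {z : ℝ × ℝ | a + i < z.1 ∧ 0 < z.2} :=
    fun i => ⟨by simp, by simp⟩
  have hmax : ∀ (i : ℤ) (A : Set (ℝ × ℝ)), IsPreconnected A → A ⊆ O i →
      ∀ x ∈ A, a + i < x.1 → 0 < x.2 → A ⊆ R i := by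
    intro i A hA hAO x hx h1 h2
    have h := IsPreconnected.union x hx
      (show x ∈ {z : ℝ × ℝ | a + i < z.1 ∧ 0 < z.2} from ⟨h1, h2⟩) hA (hqup i)
    exact Set.subset_union_left.trans (h.subset_connectedComponentIn
      (Or.inr (hbase i)) (Set.union_subset hAO (hquO i)))
  have hquR : ∀ i : ℤ, {z : ℝ × ℝ | a + i < z.1 ∧ 0 < z.2} ⊆ R i := fun i =>
    hmax i _ (hqup i) (hquO i) _ (hbase i) (hbase i).1 (hbase i).2
  have hRO : ∀ i : ℤ, R i ⊆ O i := fun i => connectedComponentIn_subset _ _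
  have hRp : ∀ i : ℤ, IsPreconnected (R i) := fun i => isPreconnected_connectedComponentIn
  have hleft : ∀ (i : ℤ), ∀ z ∈ R i, 0 < z.2 → ¬ z.1 < a + i := by
    intro i z hz h2 h1
    have e1 : (p + ((i : ℝ), (0 : ℝ))).1 = a + i := by simp [hpa]
    have e2 : (p + ((i : ℝ), (0 : ℝ))).2 = p.2 := by simp
    refine sep_lemma hQ (hKT p hpK i) ?_ hKn (hRp i) ?_ (hquR i (hbase i)) hz
      (hbase i).2 h2 ?_ ?_
    · rw [e1, e2]; exact htop i
    · rw [e1, e2]; exact hRO i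
    · rw [e1]; exact (hbase i).1
    · rw [e1]; exact h1
  obtain ⟨j, hj⟩ := exists_nat_gt (3 + 2 * C)
  set m : ℤ := L.k * j with hm
  have hmR : (m : ℝ) = L.k * j := by rw [hm]; push_cast; rfl
  have hm0 : (0 : ℝ) ≤ m := by rw [hmR]; positivity
  set G : ℝ × ℝ → ℝ × ℝ := fun z => L.F z + ((m : ℝ), (0 : ℝ)) with hG
  have hGc : Continuous G := L.F.continuous.add continuous_const
  have hGK : ∀ z, G z ∈ K ↔ z ∈ K := by
    intro z
    constructor
    · intro h
      have := hKT _ h (-m)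
      apply (hKF z).mp
      simpa [hG, add_assoc, Prod.mk_zero_zero] using this
    · intro h
      exact hKT _ ((hKF z).mpr h) m
  have hest : ∀ (i b : ℤ), b ≤ i + 2 → ∀ u, (G u).1 = a + b → p.2 < (G u).2 → u.1 < a + i := by
    intro i b hb u h1 h2
    have c1 := (abs_le.mp (hC u).1).1
    have c2 := (abs_le.mp (hC u).2).2
    have g1 : (G u).1 = (L.F u).1 + m := rfl
    have g2 : (G u).2 = (L.F u).2 := by simp [hG]
    rw [g1] at h1
    rw [g2] at h2
    have hbR : (b : ℝ) ≤ i + 2 := by exact_mod_cast hb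
    have h3 : -1 - C ≤ u.2 := by linarith
    have h4 : (L.k : ℝ) * (-1 - C) ≤ L.k * u.2 := by gcongr
    have h5 : 1 * ((j : ℝ) - 1 - C) ≤ L.k * (j - 1 - C) := by
      apply mul_le_mul_of_nonneg_right hk1; linarith
    nlinarith
  have hGinv : ∀ w : ℝ × ℝ, G (L.F.symm (w + ((-m : ℝ), (0 : ℝ)))) = w := by
    intro w
    simp only [hG, Homeomorph.apply_symm_apply]
    ext <;> simp
  have hmiss : ∀ (i b : ℤ), b ≤ i + 2 → ∀ z ∈ R i, ¬ ((G z).1 = a + b ∧ p.2 < (G z).2) := by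
    rintro i b hb z hz ⟨h1, h2⟩
    set Λ : Set (ℝ × ℝ) := {w | w.1 = a + b ∧ p.2 < w.2} with hΛ
    have hΛp : IsPreconnected Λ := by
      have c1 : Convex ℝ {z : ℝ × ℝ | z.1 = a + b} :=
        convex_hyperplane (f := fun z : ℝ × ℝ => z.1) ⟨fun _ _ => rfl, fun _ _ => rfl⟩ _
      have c2 : Convex ℝ {z : ℝ × ℝ | p.2 < z.2} :=
        convex_halfSpace_gt (f := fun z : ℝ × ℝ => z.2) ⟨fun _ _ => rfl, fun _ _ => rfl⟩ _
      exact (c1.inter c2).isPreconnected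
    have hinvc : Continuous fun w : ℝ × ℝ => L.F.symm (w + ((-m : ℝ), (0 : ℝ))) :=
      L.F.symm.continuous.comp (continuous_id.add continuous_const)
    have hAp := hΛp.image _ hinvc.continuousOn
    have hzA : z ∈ (fun w : ℝ × ℝ => L.F.symm (w + ((-m : ℝ), (0 : ℝ)))) '' Λ := by
      refine ⟨G z, ⟨h1, h2⟩, ?_⟩
      simp [hG, add_assoc, Prod.mk_zero_zero]
    have hAO : (fun w : ℝ × ℝ => L.F.symm (w + ((-m : ℝ), (0 : ℝ)))) '' Λ ⊆ O i := by
      rintro _ ⟨w, hw, rfl⟩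
      have hGw := hGinv w
      refine ⟨fun hK => ?_, fun h => ?_⟩
      · have := (hGK _).mpr hK
        rw [hGw] at this
        exact absurd (htop b w this hw.1) (not_le.mpr hw.2)
      · have := hest i b hb _ (by rw [hGw]; exact hw.1) (by rw [hGw]; exact hw.2)
        exact absurd h.1 this.ne
    have hAR : (fun w : ℝ × ℝ => L.F.symm (w + ((-m : ℝ), (0 : ℝ)))) '' Λ ⊆ R i := by
      have : R i = connectedComponentIn (O i) z := connectedComponentIn_eq hz
      rw [this]
      exact hAp.subset_connectedComponentIn hzA hAO
    have hwΛ : ((a + b, C + 1) : ℝ × ℝ) ∈ Λ := ⟨rfl, by change p.2 < C + 1; linarith⟩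
    have hGw := hGinv (a + b, C + 1)
    have hu := hAR (Set.mem_image_of_mem _ hwΛ)
    set u := L.F.symm ((a + b, C + 1) + ((-m : ℝ), (0 : ℝ))) with hudef
    have c2 := (abs_le.mp (hC u).2).2
    have g2 : (G u).2 = (L.F u).2 := by simp [hG]
    have g3 : (L.F u).2 = C + 1 := by rw [← g2, hGw]
    refine hleft i u hu (by linarith) (hest i b hb u ?_ ?_)
    · rw [hGw]
    · rw [hGw]; change p.2 < C + 1; linarith
  have hGR : ∀ (i b : ℤ), b ≤ i + 2 → ∀ z ∈ R i, G z ∈ R b := by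
    intro i b hb z hz
    have hmem : ((a + i + 1, C + 2) : ℝ × ℝ) ∈ R i :=
      hquR i ⟨by simp, by change 0 < C + 2; linarith⟩
    have hs : G '' R i ⊆ R b := by
      apply hmax b _ ((hRp i).image G hGc.continuousOn) _ _ (Set.mem_image_of_mem G hmem)
      · have c1 := (abs_le.mp (hC (a + i + 1, C + 2)).1).1
        have hbR : (b : ℝ) ≤ i + 2 := by exact_mod_cast hb
        have h3 : 1 * (C + 2) ≤ L.k * (C + 2) := by
          apply mul_le_mul_of_nonneg_right hk1; linarith
        have g1 : (G (a + i + 1, C + 2)).1 = (L.F (a + i + 1, C + 2)).1 + m := rfl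
        rw [g1]
        dsimp only at c1
        linarith
      · have c2 := (abs_le.mp (hC (a + i + 1, C + 2)).2).1
        have g2 : (G (a + i + 1, C + 2)).2 = (L.F (a + i + 1, C + 2)).2 := by simp [hG]
        rw [g2]
        dsimp only at c2
        linarith
      · rintro _ ⟨w, hw, rfl⟩
        exact ⟨fun h => (hRO i hw).1 ((hGK w).mp h), hmiss i b hb w hw⟩
    exact hs (Set.mem_image_of_mem G hz)
  have hconj : ∀ (n : ℕ) (z : ℝ × ℝ),
      (⇑L.F)^[n] (z + ((0 : ℝ), ((j : ℤ) : ℝ))) = G^[n] z + ((0 : ℝ), ((j : ℤ) : ℝ)) := by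
    intro n
    induction n with
    | zero => intro z; rfl
    | succ n ih =>
      intro z
      rw [Function.iterate_succ_apply, Function.iterate_succ_apply, ← ih, L.vert_int]
      congr 1
      simp only [hG]
      ext
      · simp [hmR]
      · simp
  refine ⟨1 + j, by positivity, fun x n hn y hy hx => ?_⟩
  by_contra hge
  push Not at hge
  set i : ℤ := ⌈x - a⌉ - 1 with hi
  have hi1 : a + i < x := by
    have := Int.ceil_lt_add_one (x - a)
    rw [hi]; push_cast; linarith
  have hi2 : x < a + (i + 2 : ℤ) := by
    have := Int.le_ceil (x - a)
    rw [hi]; push_cast; linarith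
  have hxy : ((x, y) : ℝ × ℝ) = (x, y - j) + ((0 : ℝ), ((j : ℤ) : ℝ)) := by ext <;> simp
  have hmem : ∀ q : ℕ, G^[q + 1] (x, y - j) ∈ R (i + 2) := by
    intro q
    induction q with
    | zero =>
      exact hGR i (i + 2) le_rfl _ (hquR i ⟨hi1, by change 0 < y - j; linarith⟩)
    | succ q ih =>
      rw [Function.iterate_succ_apply']
      exact hGR (i + 2) (i + 2) (by omega) _ ih
  obtain ⟨q, rfl⟩ : ∃ q, n = q + 1 := ⟨n - 1, by omega⟩
  rw [hxy, hconj] at hx hge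
  simp only [Prod.fst_add, Prod.snd_add, add_zero, Int.cast_natCast] at hx hge
  refine hleft (i + 2) _ (hmem q) (by linarith) ?_
  rw [hx]; exact hi2

/-- The conjugate of a lift by the central symmetry. -/
def reflect (L : DehnLift) : DehnLift where
  F := ((Homeomorph.neg (ℝ × ℝ)).trans L.F).trans (Homeomorph.neg (ℝ × ℝ))
  k := L.k
  k_pos := L.k_pos
  horiz := by
    intro x y
    have h := L.horiz_int (-1) (-x, -y)
    have e : -((x + 1, y) : ℝ × ℝ) = (-x, -y) + (((-1 : ℤ) : ℝ), (0 : ℝ)) := by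
      ext <;> simp; ring
    change -(L.F (-(x + 1, y))) = -(L.F (-x, -y)) + (1, 0)
    rw [e, h]
    ext <;> simp; ring
  vert := by
    intro x y
    have h := L.vert_int (-1) (-x, -y)
    have e : -((x, y + 1) : ℝ × ℝ) = (-x, -y) + ((0 : ℝ), ((-1 : ℤ) : ℝ)) := by
      ext <;> simp; ring
    change -(L.F (-(x, y + 1))) = -(L.F (-x, -y)) + ((L.k : ℝ), 1)
    rw [e, h]
    ext <;> simp <;> ring

theorem reflect_iter (L : DehnLift) (n : ℕ) (z : ℝ × ℝ) :
    (⇑L.reflect.F)^[n] z = -((⇑L.F)^[n] (-z)) := by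
  induction n generalizing z with
  | zero => simp
  | succ n ih =>
    rw [Function.iterate_succ_apply, Function.iterate_succ_apply, ih]
    have : L.reflect.F z = -(L.F (-z)) := rfl
    rw [this, neg_neg]

theorem reflect_rotZ (L : DehnLift) (h : L.RotZ) : L.reflect.RotZ := by
  intro ε hε
  obtain ⟨N, hN⟩ := h ε hε
  refine ⟨N, fun n hn z => ?_⟩
  have := hN n hn (-z)
  rw [reflect_iter, ← abs_neg]
  convert this using 2
  simp; ring

end DehnLift

/-- If `ρ_V(f̂) = {0}`, there exists `M′ > 0` such that every
vertical half-line `{x̃} × [M′,∞)` or `{x̃} × (−∞,−M′]` is free under every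
positive iterate of the plane lift `f̃`. -/
theorem vertical_half_lines_free
    (L : DehnLift) (fhat : Cyl → Cyl)
    (hfhat : ∀ z : ℝ × ℝ, projCyl (L.F z) = fhat (projCyl z))
    (hrot : rotSet fhat = {(0:ℝ)}) :
    ∃ M' > (0:ℝ), ∀ x : ℝ, ∀ n : ℕ, 0 < n →
      ((⇑L.F)^[n] '' ({x} ×ˢ Set.Ici M') ∩ ({x} ×ˢ Set.Ici M') = ∅) ∧
      ((⇑L.F)^[n] '' ({x} ×ˢ Set.Iic (-M')) ∩ ({x} ×ˢ Set.Iic (-M')) = ∅) := by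
  have hZ := L.rotZ_of_rotSet fhat hfhat hrot
  obtain ⟨M1, hM1, h1⟩ := L.upper hZ
  obtain ⟨M2, hM2, h2⟩ := L.reflect.upper (L.reflect_rotZ hZ)
  refine ⟨max M1 M2, lt_max_of_lt_left hM1, fun x n hn => ⟨?_, ?_⟩⟩
  · rw [Set.eq_empty_iff_forall_notMem]
    rintro _ ⟨⟨⟨u, v⟩, ⟨hu, hv⟩, rfl⟩, hx, hy⟩
    simp only [Set.mem_singleton_iff, Set.mem_Ici] at hu hv hx hy
    subst hu
    have := h1 u n hn v ((le_max_left _ _).trans hv) hx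
    linarith [le_max_left M1 M2]
  · rw [Set.eq_empty_iff_forall_notMem]
    rintro _ ⟨⟨⟨u, v⟩, ⟨hu, hv⟩, rfl⟩, hx, hy⟩
    simp only [Set.mem_singleton_iff, Set.mem_Iic] at hu hv hx hy
    subst hu
    have e : (⇑L.reflect.F)^[n] (-u, -v) = -((⇑L.F)^[n] (u, v)) := by
      rw [L.reflect_iter]; simp
    have := h2 (-u) n hn (-v) (by linarith [le_max_right M1 M2]) (by rw [e]; simp [hx])
    rw [e, Prod.snd_neg] at this
    linarith [le_max_right M1 M2]
end
end

section
/- Let f be a homeomorphism of the torus T² homotopic to a Dehn twist that preserves Lebesgue measure, and let f̂ be a lift of f to the vertical cylinder A with zero Lebesgue-measure vertical rotation number (∫_{T²} φ dLeb = 0, where φ is the vertical displacement function of f̂). Then f̂ is exact: for every b ∈ ℝ, Leb( H_b⁺ ∩ f̂(H_b⁻) ) = Leb( H_b⁻ ∩ f̂(H_b⁺) ), where H_b⁻ = (ℝ/ℤ)×(−∞,b], H_b⁺ = (ℝ/ℤ)×[b,∞), and Leb denotes Lebesgue measure on the cylinder. -/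
noncomputable section

open MeasureTheory

open Set in
lemma lint_real_unfold (h : ℝ → ENNReal) (hh : Measurable h) :
    ∫⁻ y, h y = ∫⁻ y in Ioc (0:ℝ) (0+1), ∑' n : ℤ, h (y + n) := by
  have hm : ∀ n : ℤ, Measurable (fun y : ℝ => h (y + n)) := fun n =>
    hh.comp (measurable_id.add_const _)
  rw [lintegral_tsum (fun n => (hm n).aemeasurable)]
  rw [← setLIntegral_univ, ← iUnion_Ioc_add_intCast (0:ℝ),
    lintegral_iUnion (fun i => measurableSet_Ioc) (pairwise_disjoint_Ioc_add_intCast (0:ℝ))]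
  congr 1
  ext n
  have := (measurePreserving_add_right (volume : Measure ℝ) (n:ℝ)).setLIntegral_comp_preimage
    (s := Ioc (0 + (n:ℝ)) (0 + n + 1)) measurableSet_Ioc hh
  rw [← this]
  congr 2
  ext y
  simp only [mem_preimage, mem_Ioc]
  constructor <;> rintro ⟨h1, h2⟩ <;> constructor <;> linarith

open Set in
lemma vol_cyl_unfold (S : Set Cyl) (hS : MeasurableSet S) (N : Torus → ENNReal)
    (hN : Measurable N)
    (h : ∀ (x : AddCircle (1:ℝ)) (y : ℝ),
      ∑' n : ℤ, S.indicator 1 (x, y + (n:ℝ)) = N (x, (y : AddCircle (1:ℝ)))) :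
    volume S = ∫⁻ w, N w := by
  rw [← lintegral_indicator_one hS]
  change ∫⁻ a, S.indicator 1 a ∂((volume : Measure (AddCircle (1:ℝ))).prod (volume : Measure ℝ))
    = ∫⁻ w, N w ∂((volume : Measure (AddCircle (1:ℝ))).prod (volume : Measure (AddCircle (1:ℝ))))
  have hm : Measurable (S.indicator (1 : Cyl → ENNReal)) := measurable_one.indicator hS
  rw [lintegral_prod _ hm.aemeasurable, lintegral_prod _ hN.aemeasurable]
  congr 1
  ext x
  rw [lint_real_unfold (fun y => S.indicator 1 (x, y)) (hm.comp measurable_prodMk_left)]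
  rw [← AddCircle.lintegral_preimage 1 0 (fun t => N (x, t))]
  congr 1
  ext y
  exact h x y

lemma tsum_count (p q : ℤ) (P : ℤ → Prop) [DecidablePred P] (hP : ∀ n, P n ↔ p ≤ n ∧ n < q) :
    ∑' n : ℤ, (if P n then (1 : ENNReal) else 0) = ENNReal.ofReal ((q:ℝ) - p) := by
  rw [tsum_eq_sum (s := Finset.Ico p q)]
  · rw [Finset.sum_congr rfl (g := fun _ => (1 : ENNReal))]
    · simp only [Finset.sum_const, Int.card_Ico, nsmul_eq_mul, mul_one]
      rw [← ENNReal.ofReal_natCast]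
      rcases le_total p q with h | h
      · congr 1
        have : ((q - p).toNat : ℤ) = q - p := Int.toNat_of_nonneg (by omega)
        exact_mod_cast this
      · have h' : (q:ℝ) ≤ p := by exact_mod_cast h
        rw [Int.toNat_of_nonpos (by omega), ENNReal.ofReal_of_nonpos (p := (q:ℝ) - p) (by linarith)]
        simp
    · intro n hn
      rw [Finset.mem_Ico] at hn
      simp [(hP n).2 hn]
  · intro n hn
    rw [Finset.mem_Ico] at hn
    rw [if_neg]
    rwa [hP]

lemma null_cyl (Z : Set Torus) (hZ : MeasurableSet Z) (h0 : volume Z = 0) :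
    volume ((fun u : Cyl => ((u.1, (u.2 : AddCircle (1:ℝ))) : Torus)) ⁻¹' Z) = 0 := by
  have hp : Measurable (fun u : Cyl => ((u.1, (u.2 : AddCircle (1:ℝ))) : Torus)) :=
    measurable_fst.prodMk (AddCircle.measurable_mk'.comp measurable_snd)
  rw [vol_cyl_unfold _ (hp hZ) (Z.indicator (fun _ => ⊤)) (measurable_const.indicator hZ)]
  · rw [lintegral_indicator hZ]
    simp [h0]
  · intro x y
    classical
    simp only [Set.indicator_apply, Set.mem_preimage, AddCircle.coe_add]
    have : ∀ n : ℤ, ((n : ℝ) : AddCircle (1:ℝ)) = 0 := by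
      intro n
      rw [AddCircle.coe_eq_zero_iff]
      exact ⟨n, by simp⟩
    simp only [this, add_zero]
    by_cases h : ((x, (y : AddCircle (1:ℝ))) : Torus) ∈ Z
    · simp [h]
    · simp [h]

/-- fractional part of `t - b` on the circle -/
def fracC (b : ℝ) (t : AddCircle (1:ℝ)) : ℝ :=
  (AddCircle.equivIco (1:ℝ) 0 (t - (b : AddCircle (1:ℝ))) : ℝ)

lemma fracC_meas (b : ℝ) : Measurable (fracC b) :=
  measurable_subtype_coe.comp ((AddCircle.measurableEquivIco (1:ℝ) 0).measurable.comp
    (measurable_id.sub_const _))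

lemma fracC_coe (b y : ℝ) : fracC b (y : AddCircle (1:ℝ)) = (⌈b - y⌉ : ℝ) - (b - y) := by
  unfold fracC
  rw [← AddCircle.coe_sub, AddCircle.coe_equivIco_mk_apply]
  have h : (y - b) = -(b - y) := by ring
  simp only [div_one, mul_one]
  rw [h, ← Int.self_sub_floor, Int.floor_neg]
  push_cast
  ring

lemma fracC_bound (b : ℝ) (t : AddCircle (1:ℝ)) : ‖fracC b t‖ ≤ 1 := by
  have := (AddCircle.equivIco (1:ℝ) 0 (t - (b : AddCircle (1:ℝ)))).2
  rw [Set.mem_Ico] at this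
  rw [Real.norm_eq_abs, abs_le]
  unfold fracC
  constructor <;> linarith [this.1, this.2]

lemma lint_pos_eq_neg (D : Torus → ℝ) (hD : Integrable D) (h0 : ∫ w, D w = 0) :
    ∫⁻ w, ENNReal.ofReal (D w) = ∫⁻ w, ENNReal.ofReal (-D w) := by
  rw [integral_eq_lintegral_pos_part_sub_lintegral_neg_part hD, sub_eq_zero] at h0
  refine (ENNReal.toReal_eq_toReal_iff' ?_ ?_).1 h0
  · exact hD.lintegral_lt_top.ne
  · exact hD.neg.lintegral_lt_top.ne

/-- An area-preserving Dehn twist homeomorphism whose lift has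
zero Lebesgue-measure vertical rotation number is exact: for every `b`, the
area of `H_b⁺ ∩ f̂(H_b⁻)` equals the area of `H_b⁻ ∩ f̂(H_b⁺)`. -/
theorem zero_rotation_number_implies_exact
    (L : DehnLift) (f : Torus ≃ₜ Torus)
    (hf : ∀ z : ℝ × ℝ, projTorus (L.F z) = f (projTorus z))
    (fhat : Cyl → Cyl)
    (hfhat : ∀ z : ℝ × ℝ, projCyl (L.F z) = fhat (projCyl z))
    (hpres : MeasurePreserving f volume volume)
    (φ : Torus → ℝ)
    (hφ : ∀ z : ℝ × ℝ, φ (projTorus z) = (fhat (projCyl z)).2 - z.2)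
    (hint : ∫ x, φ x = 0) :
    ∀ b : ℝ,
      volume ((Set.univ ×ˢ Set.Ici b) ∩ fhat '' (Set.univ ×ˢ Set.Iic b)) =
      volume ((Set.univ ×ˢ Set.Iic b) ∩ fhat '' (Set.univ ×ˢ Set.Ici b)) := by
  intro b
  classical
  -- the covering of the torus by the cylinder
  have hsurj : ∀ w : Torus, ∃ z, projTorus z = w := by
    rintro ⟨x, y⟩
    obtain ⟨x, rfl⟩ := QuotientAddGroup.mk_surjective x
    obtain ⟨y, rfl⟩ := QuotientAddGroup.mk_surjective y
    exact ⟨(x, y), rfl⟩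
  have hφF : ∀ z, φ (projTorus z) = (L.F z).2 - z.2 := by
    intro z
    rw [hφ, ← hfhat]
    rfl
  have hφc : Continuous φ := by
    have hq : IsOpenQuotientMap projTorus :=
      IsOpenQuotientMap.prodMap QuotientAddGroup.isOpenQuotientMap_mk
        QuotientAddGroup.isOpenQuotientMap_mk
    rw [← hq.continuous_comp_iff]
    have : φ ∘ projTorus = fun z => (L.F z).2 - z.2 := funext hφF
    rw [this]
    fun_prop
  let ψ : Torus → ℝ := fun w => φ (f.symm w)
  have hψc : Continuous ψ := hφc.comp f.symm.continuous
  have hsymm : MeasurePreserving f.symm (volume : Measure Torus) volume :=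
    MeasurePreserving.symm f.toMeasurableEquiv hpres
  have hemb : MeasurableEmbedding f.symm := f.symm.measurableEmbedding
  have hψ0 : ∫ w, ψ w = 0 := by
    rw [← hint]
    exact hsymm.integral_comp hemb φ
  have hψf : ∀ w : Torus, (f.symm w).2 = w.2 - (ψ w : AddCircle (1:ℝ)) := by
    intro w
    obtain ⟨z, hz⟩ := hsurj (f.symm w)
    have hw : w = projTorus (L.F z) := by rw [hf, hz]; simp
    have : ψ w = (L.F z).2 - z.2 := by
      rw [← hφF, hz]
    rw [this, ← hz, hw]
    simp [projTorus]
  let p : Cyl → Torus := fun u => (u.1, (u.2 : AddCircle (1:ℝ)))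
  have hp : Measurable p :=
    measurable_fst.prodMk (AddCircle.measurable_mk'.comp measurable_snd)
  have himg : ∀ s : Set ℝ, fhat '' (Set.univ ×ˢ s) = {u : Cyl | u.2 - ψ (p u) ∈ s} := by
    intro s
    have key : ∀ z, (projCyl (L.F z)).2 - ψ (p (projCyl (L.F z))) = z.2 := by
      intro z
      have h1 : p (projCyl (L.F z)) = f (projTorus z) := by rw [← hf]; rfl
      rw [h1]
      simp only [ψ, Homeomorph.symm_apply_apply, hφF]
      simp [projCyl]
    ext u
    constructor
    · rintro ⟨⟨x, y⟩, hz, rfl⟩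
      obtain ⟨x, rfl⟩ := QuotientAddGroup.mk_surjective x
      have := hfhat (x, y)
      have h2 : projCyl (x, y) = ((x : AddCircle (1:ℝ)), y) := rfl
      rw [h2] at this
      change (fhat ((x : AddCircle (1:ℝ)), y)).2 - ψ (p (fhat ((x : AddCircle (1:ℝ)), y))) ∈ s
      rw [← this, key]
      exact hz.2
    · intro hu
      obtain ⟨x, y⟩ := u
      obtain ⟨x, rfl⟩ := QuotientAddGroup.mk_surjective x
      have hk := key (L.F.symm (x, y))
      rw [Homeomorph.apply_symm_apply] at hk
      refine ⟨projCyl (L.F.symm (x, y)), ⟨trivial, ?_⟩, ?_⟩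
      · change (L.F.symm (x, y)).2 ∈ s
        rw [← hk]
        exact hu
      · rw [← hfhat, Homeomorph.apply_symm_apply]
        rfl
  rw [himg, himg]
  -- the integer-valued displacement
  let D : Torus → ℝ := fun w => ψ w + fracC b (f.symm w).2 - fracC b w.2
  have hC1 : Integrable (fun w : Torus => fracC b w.2) :=
    Integrable.of_bound ((fracC_meas b).comp measurable_snd).aestronglyMeasurable 1
      (Filter.Eventually.of_forall fun w => fracC_bound b _)
  have hC2 : Integrable (fun w : Torus => fracC b (f.symm w).2) :=
    (hsymm.integrable_comp_emb hemb).2 hC1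
  have hψi : Integrable ψ := hψc.integrable_of_hasCompactSupport
    (HasCompactSupport.of_compactSpace _)
  have hDi : Integrable D := (hψi.add hC2).sub hC1
  have hD0 : ∫ w, D w = 0 := by
    have e := hsymm.integral_comp hemb (fun w : Torus => fracC b w.2)
    have e1 : ∫ w, D w = (∫ w, (ψ w + fracC b (f.symm w).2)) - ∫ w : Torus, fracC b w.2 :=
      integral_sub (hψi.add hC2) hC1
    rw [e1, integral_add hψi hC2, hψ0, e]
    simp
  have hDm : Measurable D :=
    (hψc.measurable.add ((fracC_meas b).comp (measurable_snd.comp f.symm.measurable))).sub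
      ((fracC_meas b).comp measurable_snd)
  have hDv : ∀ x (y : ℝ), D (x, (y : AddCircle (1:ℝ))) =
      (⌈b - (y - ψ (x, (y : AddCircle (1:ℝ))))⌉ : ℝ) - ⌈b - y⌉ := by
    intro x y
    simp only [D]
    rw [hψf, ← AddCircle.coe_sub, fracC_coe, fracC_coe]
    ring
  have hint0 : ∀ n : ℤ, ((n : ℝ) : AddCircle (1:ℝ)) = 0 := by
    intro n
    rw [AddCircle.coe_eq_zero_iff]
    exact ⟨n, by simp⟩
  have hvm : Measurable (fun u : Cyl => u.2 - ψ (p u)) :=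
    measurable_snd.sub (hψc.measurable.comp hp)
  -- the null set
  let Z0 : Set Torus := {w | w.2 = (b : AddCircle (1:ℝ))}
  have hZ0m : MeasurableSet Z0 := measurable_snd (measurableSet_singleton _)
  have hZ0 : volume Z0 = 0 := by
    have : Z0 = Set.univ ×ˢ {(b : AddCircle (1:ℝ))} := by ext w; simp [Z0]
    rw [this, Measure.volume_eq_prod, Measure.prod_prod, ← Metric.closedBall_zero,
      AddCircle.volume_closedBall]
    simp
  have hZ1 : volume (f.symm ⁻¹' Z0) = 0 := by
    rw [hsymm.measure_preimage hZ0m.nullMeasurableSet, hZ0]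
  have hae : ∀ᵐ u : Cyl, u.2 ≠ b ∧ u.2 - ψ (p u) ≠ b := by
    have h1 := null_cyl Z0 hZ0m hZ0
    have h2 := null_cyl _ (f.symm.measurable hZ0m) hZ1
    rw [measure_eq_zero_iff_ae_notMem] at h1 h2
    filter_upwards [h1, h2] with u h1 h2
    refine ⟨fun h => h1 ?_, fun h => h2 ?_⟩
    · change (u.2 : AddCircle (1:ℝ)) = b
      rw [h]
    · change (f.symm (p u)).2 = (b : AddCircle (1:ℝ))
      rw [hψf, ← h]
      simp [p]
  have eP : volume ((Set.univ ×ˢ Set.Ici b) ∩ {u : Cyl | u.2 - ψ (p u) ∈ Set.Iic b}) =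
      volume {u : Cyl | b ≤ u.2 ∧ u.2 - ψ (p u) < b} := by
    apply measure_congr
    filter_upwards [hae] with u hu
    apply propext
    change (True ∧ b ≤ u.2) ∧ u.2 - ψ (p u) ≤ b ↔ b ≤ u.2 ∧ u.2 - ψ (p u) < b
    rw [true_and, lt_iff_le_and_ne]
    tauto
  have eM : volume ((Set.univ ×ˢ Set.Iic b) ∩ {u : Cyl | u.2 - ψ (p u) ∈ Set.Ici b}) =
      volume {u : Cyl | b ≤ u.2 - ψ (p u) ∧ u.2 < b} := by
    apply measure_congr
    filter_upwards [hae] with u hu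
    apply propext
    change (True ∧ u.2 ≤ b) ∧ b ≤ u.2 - ψ (p u) ↔ b ≤ u.2 - ψ (p u) ∧ u.2 < b
    rw [true_and, lt_iff_le_and_ne]
    tauto
  rw [eP, eM]
  have hpn : ∀ x (y : ℝ) (n : ℤ), p (x, y + (n:ℝ)) = (x, (y : AddCircle (1:ℝ))) := by
    intro x y n
    simp only [p, AddCircle.coe_add, hint0, add_zero]
  rw [vol_cyl_unfold {u : Cyl | b ≤ u.2 ∧ u.2 - ψ (p u) < b}
      ((measurableSet_le measurable_const measurable_snd).inter
      (measurableSet_lt hvm measurable_const)) (fun w => ENNReal.ofReal (D w)) hDm.ennreal_ofReal,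
    vol_cyl_unfold {u : Cyl | b ≤ u.2 - ψ (p u) ∧ u.2 < b}
      ((measurableSet_le measurable_const hvm).inter
      (measurableSet_lt measurable_snd measurable_const)) (fun w => ENNReal.ofReal (-D w))
      hDm.neg.ennreal_ofReal]
  · exact lint_pos_eq_neg D hDi hD0
  · intro x y
    simp only [Set.indicator_apply, Set.mem_inter_iff, Set.mem_setOf_eq, hpn, Pi.one_apply]
    rw [tsum_count ⌈b - (y - ψ (x, (y : AddCircle (1:ℝ))))⌉ ⌈b - y⌉, hDv]
    · rw [neg_sub]
    · intro n
      rw [Int.ceil_le, Int.lt_ceil]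
      constructor <;> rintro ⟨h1, h2⟩ <;> constructor <;> linarith
  · intro x y
    simp only [Set.indicator_apply, Set.mem_inter_iff, Set.mem_setOf_eq, hpn, Pi.one_apply]
    rw [tsum_count ⌈b - y⌉ ⌈b - (y - ψ (x, (y : AddCircle (1:ℝ))))⌉, hDv]
    intro n
    rw [Int.ceil_le, Int.lt_ceil]
    constructor <;> rintro ⟨h1, h2⟩ <;> constructor <;> linarith
end
end

section
/- Let f be a homeomorphism of the torus T² homotopic to a Dehn twist that preserves Lebesgue measure, and let f̂ be a lift of f to the vertical cylinder A with zero Lebesgue-measure vertical rotation number (∫_{T²} φ dLeb = 0, where φ is the vertical displacement function of f̂). Let H = (ℝ/ℤ)×{0}. If the forward saturation ∪_{n≥0} f̂ⁿ(H) is contained in (ℝ/ℤ)×[a,+∞) for some real a (i.e., it is bounded from below), then ∪_{n≥0} f̂ⁿ(H) is bounded; consequently ∪_{n≥0} f̂ⁿ(H) is either bounded or unbounded both from above and from below. -/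
noncomputable section

open MeasureTheory

theorem aux_cocycle {X : Type*} [MeasurableSpace X] (μ : Measure X) [IsFiniteMeasure μ]
    (f : X → X) (hf : MeasurePreserving f μ μ) (φ : X → ℝ) (hφm : Measurable φ)
    (hφi : Integrable φ μ) (hint : ∫ x, φ x ∂μ = 0) (c : ℝ)
    (hc : ∀ n x, -c ≤ birkhoffSum f φ n x) :
    ∀ᵐ x ∂μ, ∀ n, birkhoffSum f φ n x ≤ c := by
  have hfm := hf.measurable
  have hbm : ∀ n, Measurable (birkhoffSum f φ n) := by
    intro n
    unfold birkhoffSum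
    exact Finset.measurable_sum _ (fun i _ => hφm.comp (hfm.iterate i))
  have hbdd : ∀ x, BddBelow (Set.range fun n => birkhoffSum f φ n x) := by
    intro x
    refine ⟨-c, ?_⟩
    rintro _ ⟨n, rfl⟩
    exact hc n x
  set T : X → ℝ := fun x => ⨅ n, birkhoffSum f φ n x with hT
  have hTm : Measurable T := Measurable.iInf hbm
  have hT0 : ∀ x, T x ≤ 0 := fun x => by
    have := ciInf_le (hbdd x) 0
    simpa using this
  have hTc : ∀ x, -c ≤ T x := fun x => le_ciInf (fun n => hc n x)
  have hTf : ∀ x, 0 ≤ φ x + T (f x) - T x := by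
    intro x
    have : T x - φ x ≤ T (f x) := by
      refine le_ciInf (fun n => ?_)
      have h1 := ciInf_le (hbdd x) (n + 1)
      rw [birkhoffSum_succ'] at h1
      change T x ≤ _ at h1
      linarith
    linarith
  have hTi : Integrable T μ := by
    refine Integrable.of_bound hTm.aestronglyMeasurable c (Filter.Eventually.of_forall fun x => ?_)
    rw [Real.norm_eq_abs, abs_le]
    have := hT0 x
    have := hTc x
    constructor <;> linarith
  have hTfi : Integrable (fun x => T (f x)) μ := hf.integrable_comp_of_integrable hTi
  have hTfe : ∫ x, T (f x) ∂μ = ∫ x, T x ∂μ := by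
    have h := integral_map (μ := μ) hfm.aemeasurable
      (f := T) (by rw [hf.map_eq]; exact hTm.aestronglyMeasurable)
    rw [hf.map_eq] at h
    exact h.symm
  have hzero : ∫ x, (φ x + T (f x) - T x) ∂μ = 0 := by
    have hadd : Integrable (fun x => φ x + T (f x)) μ := hφi.add hTfi
    rw [integral_sub hadd hTi, integral_add hφi hTfi, hint, hTfe]
    ring
  have hae : ∀ᵐ x ∂μ, φ x + T (f x) - T x = 0 := by
    have := (integral_eq_zero_iff_of_nonneg hTf ((hφi.add hTfi).sub hTi)).1 hzero
    filter_upwards [this] with x hx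
    exact hx
  have hall : ∀ᵐ x ∂μ, ∀ n : ℕ, φ (f^[n] x) + T (f (f^[n] x)) - T (f^[n] x) = 0 := by
    rw [ae_all_iff]
    intro n
    exact (hf.iterate n).quasiMeasurePreserving.ae hae
  filter_upwards [hall] with x hx n
  have key : ∀ n, birkhoffSum f φ n x = T x - T (f^[n] x) := by
    intro n
    induction n with
    | zero => simp
    | succ n ih =>
      rw [birkhoffSum_succ, ih, Function.iterate_succ_apply']
      have := hx n
      linarith
  rw [key]
  have := hT0 x
  have := hTc (f^[n] x)
  linarith

theorem aux_cocycle_cont {X : Type*} [TopologicalSpace X] [CompactSpace X] [MeasurableSpace X]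
    [BorelSpace X] (μ : Measure X) [IsFiniteMeasure μ] [μ.IsOpenPosMeasure]
    (f : X → X) (hfc : Continuous f) (hf : MeasurePreserving f μ μ) (φ : X → ℝ)
    (hφ : Continuous φ) (hint : ∫ x, φ x ∂μ = 0) (c : ℝ)
    (hc : ∀ n x, -c ≤ birkhoffSum f φ n x) :
    ∀ n x, birkhoffSum f φ n x ≤ c := by
  have hφi : Integrable φ μ := hφ.integrable_of_hasCompactSupport (HasCompactSupport.of_compactSpace φ)
  have h := aux_cocycle μ f hf φ hφ.measurable hφi hint c hc
  intro n
  have hcont : Continuous (birkhoffSum f φ n) := by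
    unfold birkhoffSum
    exact continuous_finsetSum _ (fun i _ => hφ.comp (hfc.iterate i))
  have hcl : IsClosed {x | birkhoffSum f φ n x ≤ c} := isClosed_le hcont continuous_const
  have hd : Dense {x | birkhoffSum f φ n x ≤ c} := by
    refine Measure.dense_of_ae (μ := μ) ?_
    filter_upwards [h] with x hx using hx n
  intro x
  have : x ∈ closure {x | birkhoffSum f φ n x ≤ c} := hd x
  rwa [hcl.closure_eq] at this

theorem aux_low (G G' : ℝ × ℝ → ℝ × ℝ) (hG' : Continuous G') (h1 : ∀ z, G (G' z) = z)
    (h2 : ∀ z, G' (G z) = z) (D : ℝ) (hD : ∀ z, |(G z).2 - z.2| ≤ D) (a : ℝ)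
    (ha : ∀ x : ℝ, a ≤ (G (x, 0)).2) (z : ℝ × ℝ) (hz : 0 ≤ z.2) : a ≤ (G z).2 := by
  by_contra! hlt
  set w := G z with hw
  have hD' : ∀ u, |u.2 - (G' u).2| ≤ D := fun u => by simpa [h1] using hD (G' u)
  set s := min w.2 (-D) with hs
  have hcont : ContinuousOn (fun t : ℝ => (G' (w.1, t)).2) (Set.Icc s w.2) :=
    (continuous_snd.comp (hG'.comp (by fun_prop))).continuousOn
  have hiv := intermediate_value_Icc (min_le_left w.2 (-D)) hcont
  have h0 : (0 : ℝ) ∈ Set.Icc ((G' (w.1, s)).2) ((G' (w.1, w.2)).2) := by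
    constructor
    · have := (abs_le.1 (hD' (w.1, s))).1
      have h3 : s ≤ -D := min_le_right _ _
      simp only at this
      linarith
    · have : G' (w.1, w.2) = z := h2 z
      rw [this]; exact hz
  obtain ⟨t, ht, ht0⟩ := hiv h0
  have h4 := ha (G' (w.1, t)).1
  have h5 : ((G' (w.1, t)).1, (0 : ℝ)) = G' (w.1, t) := Prod.ext rfl ht0.symm
  rw [h5, h1] at h4
  have := ht.2
  simp only at h4
  linarith

theorem aux_high (G G' : ℝ × ℝ → ℝ × ℝ) (hG' : Continuous G') (h1 : ∀ z, G (G' z) = z)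
    (h2 : ∀ z, G' (G z) = z) (D : ℝ) (hD : ∀ z, |(G z).2 - z.2| ≤ D) (a : ℝ)
    (ha : ∀ x : ℝ, (G (x, 0)).2 ≤ a) (z : ℝ × ℝ) (hz : z.2 ≤ 0) : (G z).2 ≤ a := by
  let r : ℝ × ℝ → ℝ × ℝ := fun z => (z.1, -z.2)
  have hr : Continuous r := by fun_prop
  have hrr : ∀ z, r (r z) = z := fun z => by simp [r]
  have := aux_low (fun z => r (G (r z))) (fun z => r (G' (r z))) (by fun_prop)
    (fun z => by simp [hrr, h1]) (fun z => by simp [hrr, h2]) D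
    (fun z => by
      have := hD (r z)
      rw [← abs_neg]
      convert this using 2
      simp only [r]; ring) (-a)
    (fun x => by simpa [r] using ha x) (r z) (by simpa [r] using hz)
  simp only [hrr] at this
  simpa [r] using this

/-- For area-preserving `f` with zero Lebesgue-measure vertical
rotation number, if the forward saturation `∪_{n≥0} f̂ⁿ(H)` of the circle
`H = (ℝ/ℤ)×{0}` is bounded from below then it is bounded; consequently it is
either bounded or unbounded both from above and from below. -/
theorem forward_saturation_dichotomy
    (L : DehnLift) (f : Torus ≃ₜ Torus)
    (hf : ∀ z : ℝ × ℝ, projTorus (L.F z) = f (projTorus z))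
    (fhat : Cyl → Cyl)
    (hfhat : ∀ z : ℝ × ℝ, projCyl (L.F z) = fhat (projCyl z))
    (hpres : MeasurePreserving f volume volume)
    (φ : Torus → ℝ)
    (hφ : ∀ z : ℝ × ℝ, φ (projTorus z) = (fhat (projCyl z)).2 - z.2)
    (hint : ∫ x, φ x = 0) :
    (∀ a : ℝ,
      (∀ z ∈ ⋃ n : ℕ, fhat^[n] '' (Set.univ ×ˢ ({0} : Set ℝ)), a ≤ z.2) →
      ∃ M : ℝ, ∀ z ∈ ⋃ n : ℕ, fhat^[n] '' (Set.univ ×ˢ ({0} : Set ℝ)), |z.2| ≤ M) ∧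
    ((∃ M : ℝ, ∀ z ∈ ⋃ n : ℕ, fhat^[n] '' (Set.univ ×ˢ ({0} : Set ℝ)), |z.2| ≤ M) ∨
      (¬ BddAbove (Prod.snd '' ⋃ n : ℕ, fhat^[n] '' (Set.univ ×ˢ ({0} : Set ℝ))) ∧
       ¬ BddBelow (Prod.snd '' ⋃ n : ℕ, fhat^[n] '' (Set.univ ×ˢ ({0} : Set ℝ))))) := by
  set SH := ⋃ n : ℕ, fhat^[n] '' (Set.univ ×ˢ ({0} : Set ℝ)) with hS
  have hcyl : ∀ n z, fhat^[n] (projCyl z) = projCyl (L.F^[n] z) := by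
    intro n z
    have : Function.Semiconj projCyl L.F fhat := hfhat
    exact ((this.iterate_right n) z).symm
  have htor : ∀ n z, f^[n] (projTorus z) = projTorus (L.F^[n] z) := by
    intro n z
    have : Function.Semiconj projTorus L.F f := hf
    exact ((this.iterate_right n) z).symm
  have hbs : ∀ n z, birkhoffSum f φ n (projTorus z) = (L.F^[n] z).2 - z.2 := by
    intro n z
    induction n with
    | zero => simp
    | succ n ih =>
      rw [birkhoffSum_succ, ih, htor, hφ, ← hfhat, Function.iterate_succ_apply']
      simp [projCyl]
  have hquot : IsOpenQuotientMap projTorus := by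
    have h : IsOpenQuotientMap (fun x : ℝ => (x : AddCircle (1 : ℝ))) :=
      QuotientAddGroup.isOpenQuotientMap_mk
    exact h.prodMap h
  have hφc : Continuous φ := by
    rw [hquot.isQuotientMap.continuous_iff]
    have : φ ∘ projTorus = fun z => (L.F z).2 - z.2 := by
      funext z
      rw [Function.comp_apply, hφ, ← hfhat]
      rfl
    rw [this]
    have := L.F.continuous
    fun_prop
  have hbc : ∀ n, Continuous (birkhoffSum f φ n) := by
    intro n
    unfold birkhoffSum
    exact continuous_finsetSum _ (fun i _ => hφc.comp (f.continuous.iterate i))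
  have hD : ∀ n, ∃ D, ∀ z, |(L.F^[n] z).2 - z.2| ≤ D := by
    intro n
    obtain ⟨D, hD⟩ := isCompact_univ.exists_bound_of_continuousOn (hbc n).continuousOn
    exact ⟨D, fun z => by simpa [hbs] using hD (projTorus z) (Set.mem_univ _)⟩
  have hl : ∀ n z, L.F^[n] (L.F.symm^[n] z) = z := fun n =>
    (Function.LeftInverse.iterate L.F.apply_symm_apply n)
  have hr : ∀ n z, L.F.symm^[n] (L.F^[n] z) = z := fun n =>
    (Function.LeftInverse.iterate L.F.symm_apply_apply n)
  have hmem : ∀ n (x : ℝ), projCyl (L.F^[n] (x, 0)) ∈ SH := by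
    intro n x
    rw [hS, Set.mem_iUnion]
    exact ⟨n, projCyl (x, 0), by simp [projCyl], hcyl n _⟩
  have hmem' : ∀ z ∈ SH, ∃ n, ∃ x : ℝ, z = projCyl (L.F^[n] (x, 0)) := by
    intro z hz
    rw [hS, Set.mem_iUnion] at hz
    obtain ⟨n, ⟨u, v⟩, hu, rfl⟩ := hz
    obtain ⟨x, rfl⟩ := QuotientAddGroup.mk_surjective u
    have hv : v = 0 := by simpa using hu
    subst hv
    exact ⟨n, x, hcyl n (x, 0)⟩
  -- every point of the torus has representatives in the unit strips
  have hrep : ∀ x : Torus, ∃ z : ℝ × ℝ, projTorus z = x ∧ 0 ≤ z.2 ∧ z.2 ≤ 1 := by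
    intro x
    obtain ⟨z, rfl⟩ := hquot.surjective x
    refine ⟨(z.1, Int.fract z.2), ?_, Int.fract_nonneg _, (Int.fract_lt_one _).le⟩
    refine Prod.ext rfl ?_
    change ((Int.fract z.2 : ℝ) : AddCircle (1 : ℝ)) = (z.2 : AddCircle (1 : ℝ))
    have h : Int.fract z.2 = z.2 - ⌊z.2⌋ • (1 : ℝ) := by
      rw [zsmul_one, Int.self_sub_floor]
    rw [h, AddCircle.coe_sub, AddCircle.coe_zsmul, AddCircle.coe_period, smul_zero, sub_zero]
  have hrep' : ∀ x : Torus, ∃ z : ℝ × ℝ, projTorus z = x ∧ -1 ≤ z.2 ∧ z.2 ≤ 0 := by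
    intro x
    obtain ⟨z, rfl, h0, h1⟩ := hrep x
    refine ⟨(z.1, z.2 - 1), ?_, by simpa using h0, by simpa using h1⟩
    refine Prod.ext rfl ?_
    change ((z.2 - 1 : ℝ) : AddCircle (1 : ℝ)) = (z.2 : AddCircle (1 : ℝ))
    rw [AddCircle.coe_sub, AddCircle.coe_period, sub_zero]
  have hbelow : ∀ a : ℝ, (∀ z ∈ SH, a ≤ z.2) → ∃ M : ℝ, ∀ z ∈ SH, |z.2| ≤ M := by
    intro a ha
    have hc : ∀ n x, -(1 - a) ≤ birkhoffSum f φ n x := by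
      intro n x
      obtain ⟨z, rfl, h0, h1⟩ := hrep x
      obtain ⟨D, hD⟩ := hD n
      have := aux_low _ _ (L.F.symm.continuous.iterate n) (hl n) (hr n) D hD a
        (fun x => ha _ (hmem n x)) z h0
      rw [hbs]; linarith
    have hu := aux_cocycle_cont volume f f.continuous hpres φ hφc hint _ hc
    refine ⟨1 - a, fun z hz => ?_⟩
    obtain ⟨n, x, rfl⟩ := hmem' z hz
    have e1 := hc n (projTorus (x, 0))
    have e2 := hu n (projTorus (x, 0))
    rw [hbs] at e1 e2
    rw [abs_le]
    simp only [projCyl] at *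
    constructor <;> linarith
  have habove : ∀ a : ℝ, (∀ z ∈ SH, z.2 ≤ a) → ∃ M : ℝ, ∀ z ∈ SH, |z.2| ≤ M := by
    intro a ha
    have hneg : ∀ n x, birkhoffSum f (-φ) n x = - birkhoffSum f φ n x := by
      intro n x
      simp [birkhoffSum]
    have hc : ∀ n x, -(1 + a) ≤ birkhoffSum f (-φ) n x := by
      intro n x
      obtain ⟨z, rfl, h0, h1⟩ := hrep' x
      obtain ⟨D, hD⟩ := hD n
      have := aux_high _ _ (L.F.symm.continuous.iterate n) (hl n) (hr n) D hD a
        (fun x => ha _ (hmem n x)) z h1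
      rw [hneg, hbs]; linarith
    have hu := aux_cocycle_cont volume f f.continuous hpres (-φ) hφc.neg
      (by simp [integral_neg, hint]) _ hc
    refine ⟨1 + a, fun z hz => ?_⟩
    obtain ⟨n, x, rfl⟩ := hmem' z hz
    have e1 := hc n (projTorus (x, 0))
    have e2 := hu n (projTorus (x, 0))
    rw [hneg, hbs] at e1 e2
    rw [abs_le]
    simp only [projCyl] at *
    constructor <;> linarith
  refine ⟨hbelow, ?_⟩
  by_cases hb : ∃ M : ℝ, ∀ z ∈ SH, |z.2| ≤ M
  · exact Or.inl hb
  · refine Or.inr ⟨?_, ?_⟩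
    · rintro ⟨a, ha⟩
      exact hb (habove a fun z hz => ha ⟨z, hz, rfl⟩)
    · rintro ⟨a, ha⟩
      exact hb (hbelow a fun z hz => ha ⟨z, hz, rfl⟩)
end
end
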